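/- Let d ≥ 4, fix an appropriate family (ρ_n) and a constant K > 0, and set R_n = ⌊√(μ_1(ρ_n))⌋, c = 0.01, and (for d = 4) L_n = R_n·log^{-c}R_n. There exists C = C(d,K) < ∞ such that for all sufficiently large n, all finite nonempty A ⊆ ℤ^d, all y ∈ ℤ^d, and all positive integers T < K·R_n²: if d = 4, then E^y[ cap( X[T, ⌊K·R_n²⌋] ∩ A , R_n² ) ] ≤ C·|B(A, L_n)|·T^{-1}·log^{-1}R_n, where B(A,s) is the ℓ^∞ s-neighborhood of A; and if d ≥ 5, then E^y[ |X[T, ⌊K·R_n²⌋] ∩ A| ] ≤ C·|A|·T^{1−d/2}. -/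

import Mathlib

open MeasureTheory ProbabilityTheory Filter Topology
open scoped ENNReal NNReal Classical

noncomputable section

namespace FRIPaper

/-- The lattice `ℤ^d`. -/
abbrev Zd (d : ℕ) := Fin d → ℤ

/-- `x` and `y` are nearest neighbours in `ℤ^d` (`ℓ¹`-distance one). -/
def IsNN {d : ℕ} (x y : Zd d) : Prop := (∑ i, (x i - y i).natAbs) = 1

/-- Event that a one-sided path never visits `A` at a positive time
(i.e. `H̃_A = ∞` for the path started anywhere). -/
def NoReturn {d : ℕ} (A : Set (Zd d)) : Set (ℕ → Zd d) := {ω | ∀ t : ℕ, 0 < t → ω t ∉ A}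

/-- Event that a one-sided path does not visit `A` at a positive time `t ≤ s`
(i.e. `H̃_A > s`). -/
def NoReturnUpTo {d : ℕ} (A : Set (Zd d)) (s : ℝ) : Set (ℕ → Zd d) :=
  {ω | ∀ t : ℕ, 0 < t → (t : ℝ) ≤ s → ω t ∉ A}

/-- Specification of the law `P^x` of the discrete-time simple random walk on `ℤ^d`
started at `x`, as a measure on the path space `ℕ → ℤ^d`: it is the unique probability
measure giving each nearest-neighbour cylinder of length `T` based at `x`
probability `(2d)^{-T}`. -/
def IsSRW (d : ℕ) (x : Zd d) (P : Measure (ℕ → Zd d)) : Prop :=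
  IsProbabilityMeasure P ∧
    ∀ (T : ℕ) (w : ℕ → Zd d),
      P {ω | ∀ t ≤ T, ω t = w t} =
        if w 0 = x ∧ ∀ t < T, IsNN (w t) (w (t + 1)) then
          (((2 * d : ℕ) : ℝ≥0∞))⁻¹ ^ T else 0

/-- A family `P x`, `x ∈ ℤ^d`, of simple random walk laws. -/
def IsSRWFamily (d : ℕ) (P : Zd d → Measure (ℕ → Zd d)) : Prop := ∀ x, IsSRW d x (P x)

/-- Equilibrium measure `e_A(x) = P^x[H̃_A = ∞] 1_{x ∈ A}`. -/
def equil {d : ℕ} (P : Zd d → Measure (ℕ → Zd d)) (A : Set (Zd d)) (x : Zd d) : ℝ :=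
  if x ∈ A then (P x (NoReturn A)).toReal else 0

/-- Capacity `cap(A) = Σ_{x∈A} e_A(x)`. -/
def capacity {d : ℕ} (P : Zd d → Measure (ℕ → Zd d)) (A : Finset (Zd d)) : ℝ :=
  ∑ x ∈ A, equil P (↑A) x

/-- Truncated capacity `cap(A,T) = Σ_{x∈A} P^x[H̃_A > T·(log T)^{-10}]`. -/
def capTrunc {d : ℕ} (P : Zd d → Measure (ℕ → Zd d)) (A : Finset (Zd d)) (T : ℝ) : ℝ :=
  ∑ x ∈ A, (P x (NoReturnUpTo (↑A) (T / (Real.log T) ^ (10 : ℕ)))).toReal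

/-- `X[a,b]`, the set of points visited by the path between times `a` and `b`. -/
def walkRange {d : ℕ} (ω : ℕ → Zd d) (a b : ℕ) : Finset (Zd d) := (Finset.Icc a b).image ω

/-- `E^0[cap(X[0,T])]`. -/
def capExpect {d : ℕ} (P : Zd d → Measure (ℕ → Zd d)) (T : ℕ) : ℝ :=
  ∫ ω, capacity P (walkRange ω 0 T) ∂ (P 0)

/-- `1 + log x · 1_{d = 4}`. -/
def logFour (d : ℕ) (x : ℝ) : ℝ := 1 + if d = 4 then Real.log x else 0

/-- `ε` is the constant `ε_d = lim_{T→∞} E^0[cap(X[0,T])]·T^{-1}·(1 + log T·1_{d=4})`,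
which lies in `(0,∞)`. -/
def IsCapLimit (d : ℕ) (P : Zd d → Measure (ℕ → Zd d)) (ε : ℝ) : Prop :=
  0 < ε ∧ Tendsto (fun T : ℕ => capExpect P T * logFour d T / (T : ℝ)) atTop (𝓝 ε)

/-! ### Distributions on `ℕ` -/

/-- `ρ` is a probability distribution on `ℕ`. -/
def IsDist (ρ : ℕ → ℝ) : Prop := (∀ k, 0 ≤ ρ k) ∧ HasSum ρ 1

/-- `k`-th moment `μ_k(ρ)`. -/
def mu (k : ℕ) (ρ : ℕ → ℝ) : ℝ := ∑' l : ℕ, (l : ℝ) ^ k * ρ l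

/-- Tail `μ_k^{(m)}(ρ) = Σ_{l ≥ m} l^k ρ(l)`. -/
def muTail (k m : ℕ) (ρ : ℕ → ℝ) : ℝ := ∑' l : ℕ, if m ≤ l then (l : ℝ) ^ k * ρ l else 0

/-- An appropriate family of distributions on `ℕ`. -/
def Appropriate (ρ : ℕ → ℕ → ℝ) : Prop :=
  (∀ n, IsDist (ρ n)) ∧
  (∀ n, Summable fun l : ℕ => (l : ℝ) ^ 2 * ρ n l) ∧
  Tendsto (fun n => mu 1 (ρ n)) atTop atTop ∧
  ∀ ε : ℝ, 0 < ε → ∃ C : ℝ,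
    ∀ n, (∑' L : ℕ, if C * mu 1 (ρ n) ≤ (L : ℝ) then (L : ℝ) ^ 2 * ρ n L / mu 2 (ρ n) else 0) ≤ ε

/-- Geometric distribution `Geo(λ)(k) = λ (1-λ)^k`. -/
def geo (lam : ℝ) (k : ℕ) : ℝ := lam * (1 - lam) ^ k

/-! ### Trajectories and finitary random interlacements -/

/-- A finite trajectory in `ℤ^d`, recorded as the list of its positions. -/
abbrev Traj (d : ℕ) := List (Zd d)

/-- A point configuration: the multiplicity of each trajectory. -/
abbrev Config (d : ℕ) := Traj d → ℕ

/-- A valid trajectory: a nonempty nearest-neighbour path. -/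
def ValidTraj {d : ℕ} (η : Traj d) : Prop := η ≠ [] ∧ η.Chain' IsNN

/-- The time length `T(η)` of a trajectory. -/
def len {d : ℕ} (η : Traj d) : ℕ := η.length - 1

/-- The range of a trajectory, as a set. -/
def rangeSet {d : ℕ} (η : Traj d) : Set (Zd d) := {y | y ∈ η}

/-- The trajectory `η` visits the set `A`. -/
def hits {d : ℕ} (η : Traj d) (A : Set (Zd d)) : Prop := ∃ y ∈ η, y ∈ A

/-- Poisson probability mass `e^{-r} r^n / n!`. -/
def poissonProb (r : ℝ) (n : ℕ) : ℝ≥0∞ :=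
  ENNReal.ofReal (Real.exp (-r) * r ^ n / n.factorial)

/-- The intensity `u·π({η})` that FRI with parameters `(u,ρ)` puts on a single
trajectory `η`: trajectories of length `l` from each starting point carry mass
`u·ρ(l)/(μ₁(ρ)+1)·(2d)^{-l}` each. -/
def friIntensity (d : ℕ) (u : ℝ) (ρ : ℕ → ℝ) (η : Traj d) : ℝ :=
  if ValidTraj η then u * ρ (len η) / (mu 1 ρ + 1) * (1 / (2 * (d : ℝ))) ^ (len η) else 0

/-- `P` is the law of a Poisson point process on the countable set of trajectories
with intensity function `ι`: the multiplicities of distinct trajectories are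
independent Poisson random variables. -/
def IsPoissonPP (d : ℕ) (ι : Traj d → ℝ) (P : Measure (Config d)) : Prop :=
  IsProbabilityMeasure P ∧
    ∀ (F : Finset (Traj d)) (k : Traj d → ℕ),
      P {ω | ∀ η ∈ F, ω η = k η} = ∏ η ∈ F, poissonProb (ι η) (k η)

/-- `P` is the law of the finitary random interlacements point process `𝒳^{u,ρ}`. -/
def IsFRI (d : ℕ) (u : ℝ) (ρ : ℕ → ℝ) (P : Measure (Config d)) : Prop :=
  IsPoissonPP d (friIntensity d u ρ) P

/-- `J` is the law of an i.i.d. sequence of copies of `𝒳^{u,ρ}`. -/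
def IsFRIseq (d : ℕ) (u : ℝ) (ρ : ℕ → ℝ) (J : Measure (ℕ → Config d)) : Prop :=
  IsProbabilityMeasure J ∧
    ∀ (F : Finset (ℕ × Traj d)) (k : ℕ × Traj d → ℕ),
      J {j | ∀ p ∈ F, j p.1 p.2 = k p} = ∏ p ∈ F, poissonProb (friIntensity d u ρ p.2) (k p)

/-! ### Percolation -/

/-- The edge `{x,y}` is traversed by some trajectory of the configuration `ω`. -/
def EdgeOpen {d : ℕ} (ω : Config d) (x y : Zd d) : Prop :=
  ∃ η : Traj d, 0 < ω η ∧ ∃ i : ℕ,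
    (η[i]? = some x ∧ η[i + 1]? = some y) ∨ (η[i]? = some y ∧ η[i + 1]? = some x)

/-- The cluster of `x` in the subgraph `ℐ` induced by the configuration `ω`. -/
def Cluster {d : ℕ} (ω : Config d) (x : Zd d) : Set (Zd d) :=
  {y | Relation.ReflTransGen (EdgeOpen ω) x y}

/-- The origin lies in an infinite cluster. -/
def PercEvent (d : ℕ) : Set (Config d) := {ω | (Cluster ω 0).Infinite}

/-- The critical intensity `u_*(ρ)`, given the family `u ↦ 𝒳^{u,ρ}`. -/
def uStar (d : ℕ) (X : ℝ → Measure (Config d)) : ℝ :=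
  sInf {u : ℝ | 0 ≤ u ∧ 0 < X u (PercEvent d)}

/-- The order `u_n = μ₁(ρ)·(1 + log μ₁(ρ)·1_{d=4}) / (ε_d·μ₂(ρ))` of the
critical intensity. -/
def uN (d : ℕ) (εd : ℝ) (ρ : ℕ → ℝ) : ℝ :=
  mu 1 ρ * logFour d (mu 1 ρ) / (εd * mu 2 ρ)

/-! ### `ρ`-capacity, Green function, `κ` and `φ` -/

/-- `e_A^{(ρ)}(x) = Σ_m (μ₀^{(m)}(ρ)/(μ₁(ρ)+1))·P^x[H̃_A > m]`. -/
def equilRho {d : ℕ} (P : Zd d → Measure (ℕ → Zd d)) (ρ : ℕ → ℝ) (A : Set (Zd d))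
    (x : Zd d) : ℝ :=
  ∑' m : ℕ, (muTail 0 m ρ / (mu 1 ρ + 1)) * (P x (NoReturnUpTo A (m : ℝ))).toReal

/-- `cap^{(ρ)}(A) = Σ_{x∈A} e_A^{(ρ)}(x)`. -/
def capRho {d : ℕ} (P : Zd d → Measure (ℕ → Zd d)) (ρ : ℕ → ℝ) (A : Finset (Zd d)) : ℝ :=
  ∑ x ∈ A, equilRho P ρ (↑A) x

/-- Green's function `g(x,y) = Σ_t P^x[X_t = y]`. -/
def green {d : ℕ} (P : Zd d → Measure (ℕ → Zd d)) (x y : Zd d) : ℝ :=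
  ∑' t : ℕ, (P x {ω | ω t = y}).toReal

/-- `φ^{(ρ)}(A,B) = Σ_{x∈A} Σ_{y∈B} e_A^{(ρ)}(x) e_B^{(ρ)}(y) g(x,y)`. -/
def phiRho {d : ℕ} (P : Zd d → Measure (ℕ → Zd d)) (ρ : ℕ → ℝ) (A B : Finset (Zd d)) : ℝ :=
  ∑ x ∈ A, ∑ y ∈ B, equilRho P ρ (↑A) x * equilRho P ρ (↑B) y * green P x y

/-- `κ^{(ρ)}(A) = Σ_{x∈A} Σ_m (μ₁^{(m)}(ρ)/μ₂(ρ))·P^x[H̃_A > m]` (real-valued,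
for finite `A`). -/
def kappa {d : ℕ} (P : Zd d → Measure (ℕ → Zd d)) (ρ : ℕ → ℝ) (A : Finset (Zd d)) : ℝ :=
  ∑ x ∈ A, ∑' m : ℕ, (muTail 1 m ρ / mu 2 ρ) * (P x (NoReturnUpTo (↑A) (m : ℝ))).toReal

/-- `κ^{(ρ)}(A)` as an extended-real valued quantity, for arbitrary `A`. -/
def kappaE {d : ℕ} (P : Zd d → Measure (ℕ → Zd d)) (ρ : ℕ → ℝ) (A : Set (Zd d)) : ℝ≥0∞ :=
  ∑' x : Zd d,
    A.indicator (fun x => ∑' m : ℕ,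
      ENNReal.ofReal (muTail 1 m ρ / mu 2 ρ) * P x (NoReturnUpTo A (m : ℝ))) x

/-! ### Exploration processes -/

/-- First components: the `k`-th layer `L_k` of vertices; second components:
`∪_{i<k} L_i`.  Layer `L_{k+1}` is spanned by the trajectories of `ω` meeting `L_k`
but not `∪_{i<k} L_i`. -/
def exploreSets {d : ℕ} (ω : Config d) : ℕ → Set (Zd d) × Set (Zd d)
  | 0 => ({0}, ∅)
  | k + 1 =>
    ({y | ∃ η : Traj d, 0 < ω η ∧ hits η (exploreSets ω k).1 ∧
        ¬ hits η (exploreSets ω k).2 ∧ y ∈ η},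
      (exploreSets ω k).1 ∪ (exploreSets ω k).2)

/-- The `i`-th layer `𝓛_i` of trajectories of the exploration of the cluster of the
origin, as a sub-configuration of `ω`. -/
def exploreLayer {d : ℕ} (ω : Config d) : ℕ → Config d
  | 0 => fun _ => 0
  | k + 1 => fun η =>
      if hits η (exploreSets ω k).1 ∧ ¬ hits η (exploreSets ω k).2 then ω η else 0

/-- The vertex sets `L'_k` of the dominating exploration driven by the i.i.d.
sequence `j`. -/
def exploreSets' {d : ℕ} (j : ℕ → Config d) : ℕ → Set (Zd d)
  | 0 => {0}
  | k + 1 => {y | ∃ η : Traj d, 0 < j (k + 1) η ∧ hits η (exploreSets' j k) ∧ y ∈ η}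

/-- The trajectory layers `𝓛'_i` of the dominating exploration. -/
def exploreLayer' {d : ℕ} (j : ℕ → Config d) : ℕ → Config d
  | 0 => fun _ => 0
  | k + 1 => fun η => if hits η (exploreSets' j k) then j (k + 1) η else 0

/-- `W_k = 𝔼[κ^{(ρ)}(L'_k)]`. -/
def Wexp {d : ℕ} (P : Zd d → Measure (ℕ → Zd d)) (ρ : ℕ → ℝ)
    (J : Measure (ℕ → Config d)) (k : ℕ) : ℝ≥0∞ :=
  ∫⁻ j, kappaE P ρ (exploreSets' j k) ∂ J

/-- `V_k = 𝔼[|L'_k|]`, multiplied by `(log μ₁(ρ))⁻¹` when `d = 4`. -/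
def Vexp (d : ℕ) (ρ : ℕ → ℝ) (J : Measure (ℕ → Config d)) (k : ℕ) : ℝ≥0∞ :=
  (if d = 4 then ENNReal.ofReal (1 / Real.log (mu 1 ρ)) else 1) *
    ∫⁻ j, ENat.toENNReal (exploreSets' j k).encard ∂ J

/-! ### Two-sided finite random walk trajectories -/

/-- `μ(x,m,l)({η})`: the two-sided path `(X_{-m},…,X_l)` of a doubly infinite walk
with `X_0 = x` equals the list `η` (of length `m+l+1`, with `η[m] = x`)
with probability `(2d)^{-(m+l)}` for every admissible nearest-neighbour list. -/
def twoSidedProb (d : ℕ) (x : Zd d) (m l : ℕ) (η : Traj d) : ℝ :=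
  if η.length = m + l + 1 ∧ η.Chain' IsNN ∧ η[m]? = some x then
    (1 / (2 * (d : ℝ))) ^ (m + l) else 0

/-- The `ℓ^∞`-diameter of the range of `η` is at most `R`. -/
def DiamLE {d : ℕ} (η : Traj d) (R : ℝ) : Prop :=
  ∀ a ∈ η, ∀ b ∈ η, ∀ i, |((a i - b i : ℤ) : ℝ)| ≤ R

/-- `P^x[X[-m,-1] ∩ A = ∅]`: the probability that an `m`-step walk from `x`
avoids `A` at all positive times, written combinatorially. -/
def backAvoidProb (d : ℕ) (A : Set (Zd d)) (x : Zd d) (m : ℕ) : ℝ :=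
  ∑' w : Traj d,
    if w.length = m + 1 ∧ w.Chain' IsNN ∧ w[0]? = some x ∧
        (∀ i : ℕ, 0 < i → ∀ y, w[i]? = some y → y ∉ A) then
      (1 / (2 * (d : ℝ))) ^ m else 0

/-- `μ(x,m,l;A)({η}) = P^x[X[-m,l] = η | X[-m,-1] ∩ A = ∅]`. -/
def condTwoSidedProb (d : ℕ) (A : Set (Zd d)) (x : Zd d) (m l : ℕ) (η : Traj d) : ℝ :=
  (if ∀ i < m, ∀ y, η[i]? = some y → y ∉ A then twoSidedProb d x m l η else 0) /
    backAvoidProb d A x m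

/-- `π_A({η}) = Σ_{x∈A} Σ_{m,l} (ρ(m+l)/(μ₁(ρ)+1))·P^x[H̃_A > m]·μ(x,m,l;A)({η})`. -/
def piA (d : ℕ) (P : Zd d → Measure (ℕ → Zd d)) (ρ : ℕ → ℝ) (A : Finset (Zd d))
    (η : Traj d) : ℝ :=
  ∑ x ∈ A, ∑' m : ℕ, ∑' l : ℕ,
    ρ (m + l) / (mu 1 ρ + 1) * (P x (NoReturnUpTo (↑A) (m : ℝ))).toReal *
      condTwoSidedProb d (↑A) x m l η

/-- The sub-configuration of trajectories meeting `A`, i.e. `𝒳[A]`. -/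
def restrictConfig {d : ℕ} (A : Finset (Zd d)) (ω : Config d) : Config d :=
  fun η => if hits η (↑A) then ω η else 0

/-! ### Products and geometric laws -/

/-- The geometric measure `Geo(1/(T+1))` on `ℕ`. -/
def geoMeasure (T : ℕ) : Measure ℕ :=
  Measure.sum fun k : ℕ => (ENNReal.ofReal (geo (1 / ((T : ℝ) + 1)) k)) • Measure.dirac k

/-- `Q` is the product (independent coupling) of `μ` and `ν`. -/
def IsProdOf {α β : Type*} [MeasurableSpace α] [MeasurableSpace β]
    (Q : Measure (α × β)) (μ : Measure α) (ν : Measure β) : Prop :=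
  IsProbabilityMeasure Q ∧
    ∀ (A : Set α) (B : Set β), MeasurableSet A → MeasurableSet B → Q (A ×ˢ B) = μ A * ν B

/-! ### Coarse graining quantities -/

/-- The constant `c = 0.01`. -/
def cConst : ℝ := 0.01

/-- `R_n = ⌊√(μ₁(ρ_n))⌋`. -/
def Rn (ρ : ℕ → ℕ → ℝ) (n : ℕ) : ℕ := ⌊Real.sqrt (mu 1 (ρ n))⌋₊

/-- The mesoscopic scale `L_n`. -/
def Ln (d : ℕ) (ρ : ℕ → ℕ → ℝ) (n : ℕ) : ℝ :=
  if d = 4 then (Rn ρ n : ℝ) * (Real.log (Rn ρ n)) ^ (-cConst)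
  else (Rn ρ n : ℝ) ^ ((2 + cConst) / ((d : ℝ) - 2))

/-- The slowly growing factor `I_n`. -/
def In (d : ℕ) (ρ : ℕ → ℕ → ℝ) (n : ℕ) : ℝ :=
  if d = 4 then (Real.log (Rn ρ n)) ^ cConst else (Rn ρ n : ℝ) ^ cConst

/-- The scale `T'_n`. -/
def Tn' (d : ℕ) (ρ : ℕ → ℕ → ℝ) (n : ℕ) : ℕ :=
  if d = 4 then ⌊(Rn ρ n : ℝ) ^ (2 : ℕ) / Real.log (mu 1 (ρ n))⌋₊
  else ⌊(Rn ρ n : ℝ) ^ ((2 : ℝ) - cConst / 4)⌋₊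

/-- The scale `l_n`. -/
def lnPar (d : ℕ) (ρ : ℕ → ℕ → ℝ) (n : ℕ) : ℕ :=
  if d = 4 then ⌊(Rn ρ n : ℝ) * (Real.log (Rn ρ n)) ^ (-(2 * cConst))⌋₊
  else ⌊(Rn ρ n : ℝ) ^ ((1 : ℝ) - cConst / 4)⌋₊

/-- The scale `t_n`. -/
def tnPar (d : ℕ) (ρ : ℕ → ℕ → ℝ) (n : ℕ) : ℕ :=
  if d = 4 then ⌊(Rn ρ n : ℝ) ^ (2 : ℕ) / (Real.log (Rn ρ n)) ^ (10 : ℕ)⌋₊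
  else ⌊(Rn ρ n : ℝ) ^ ((2 : ℝ) - cConst)⌋₊

/-- `y` is within `ℓ^∞`-distance `r` of `z`. -/
def InBall {d : ℕ} (y z : Zd d) (r : ℝ) : Prop := ∀ i, |((y i - z i : ℤ) : ℝ)| ≤ r

/-- The `ℓ^∞` `r`-neighbourhood `B(A,r)`. -/
def nbhd {d : ℕ} (A : Set (Zd d)) (r : ℝ) : Set (Zd d) := {y | ∃ z ∈ A, InBall y z r}

/-- The sub-path `η[a, b]` of a trajectory. -/
def segment {d : ℕ} (η : Traj d) (a b : ℕ) : Traj d := (η.drop a).take (b - a + 1)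

/-- `η` is a typical trajectory (the event `𝒯_n = ℰ₁ ∩ ℰ₂ ∩ ℰ₃ ∩ ℰ₄`). -/
def Typical (d : ℕ) (P : Zd d → Measure (ℕ → Zd d)) (εd : ℝ) (ρ : ℕ → ℕ → ℝ)
    (kk KK M θ1 : ℝ) (n : ℕ) (η : Traj d) : Prop :=
  ValidTraj η ∧
  -- ℰ₁
  (kk * (Rn ρ n : ℝ) ^ 2 ≤ (len η : ℝ) ∧ (len η : ℝ) ≤ KK * (Rn ρ n : ℝ) ^ 2 ∧
    ∀ y ∈ η, InBall y η.headI (M * (Rn ρ n : ℝ))) ∧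
  -- ℰ₂
  (if d = 4 then
    (1 - θ1 ^ 2) * (Real.pi ^ 2 / 8) * (len η : ℝ) / Real.log (mu 1 (ρ n)) <
        capacity P η.toFinset ∧
      capTrunc P η.toFinset ((Rn ρ n : ℝ) ^ 2) <
        (1 + θ1 ^ 2) * (Real.pi ^ 2 / 8) * (len η : ℝ) / Real.log (mu 1 (ρ n))
  else
    (1 - θ1 ^ 2) * εd * (len η : ℝ) < capacity P η.toFinset ∧
      capacity P η.toFinset < (1 + θ1 ^ 2) * εd * (len η : ℝ)) ∧
  -- ℰ₃
  ((Set.ncard (nbhd (rangeSet η) (Ln d ρ n)) : ℝ) <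
    (Rn ρ n : ℝ) ^ 2 * (Ln d ρ n) ^ (d - 2) * (In d ρ n) ^ ((1 : ℝ) / 3)) ∧
  -- ℰ₄
  (∀ j : ℕ, j * Tn' d ρ n ≤ len η →
    if d = 4 then
      capacity P (segment η (j * Tn' d ρ n) (min ((j + 1) * Tn' d ρ n) (len η))).toFinset ≤
          (1 + θ1 ^ 2) * (Real.pi ^ 2 / 8) * (Tn' d ρ n : ℝ) / Real.log (mu 1 (ρ n)) ∧
        ∀ a ∈ segment η (j * Tn' d ρ n) (min ((j + 1) * Tn' d ρ n) (len η)),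
          ∀ b ∈ segment η (j * Tn' d ρ n) (min ((j + 1) * Tn' d ρ n) (len η)),
            ∀ i, |((a i - b i : ℤ) : ℝ)| <
              (1 / 2) * Real.sqrt (len η : ℝ) * (Real.log (mu 1 (ρ n))) ^ (-cConst)
    else
      capacity P (segment η (j * Tn' d ρ n) (min ((j + 1) * Tn' d ρ n) (len η))).toFinset ≤
        (1 + θ1 ^ 2) * εd * (Tn' d ρ n : ℝ))

/-- `x` belongs to the `*`-proper part `η̂` of the trajectory `η`. -/
def ProperStar (d : ℕ) (P : Zd d → Measure (ℕ → Zd d)) (ρ : ℕ → ℕ → ℝ)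
    (θ1 θ2 : ℝ) (n : ℕ) (η : Traj d) (x : Zd d) : Prop :=
  x ∈ rangeSet η ∧
    (if d = 4 then
      θ2 / Real.log (mu 1 (ρ n)) ≤ equil P (rangeSet η) x ∧
        (P x (NoReturnUpTo (rangeSet η)
            ((Rn ρ n : ℝ) ^ 2 / (Real.log (Rn ρ n)) ^ (10 : ℕ)))).toReal ≤
          (1 + θ1) * equil P (rangeSet η) x
    else θ2 ≤ equil P (rangeSet η) x)


/-! ### Proof: basic operators -/

/-- The `2d` unit steps. -/
def stp {d : ℕ} (s : Fin d × Bool) : Zd d := Pi.single s.1 (if s.2 then 1 else -1)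

/-- The averaging (transition) operator of the simple random walk. -/
def Pop (d : ℕ) : (Zd d → ℝ) →ₗ[ℝ] (Zd d → ℝ) where
  toFun f x := (1 / (2 * (d : ℝ))) * ∑ s : Fin d × Bool, f (x + stp s)
  map_add' f g := by
    funext x; simp [Finset.sum_add_distrib, mul_add]
  map_smul' c f := by
    funext x; simp only [Pi.smul_apply, smul_eq_mul, RingHom.id_apply, ← Finset.mul_sum]; ring

theorem Pop_apply {d : ℕ} (f : Zd d → ℝ) (x : Zd d) :
    Pop d f x = (1 / (2 * (d : ℝ))) * ∑ s : Fin d × Bool, f (x + stp s) := rfl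

theorem stp_injective {d : ℕ} : Function.Injective (stp : Fin d × Bool → Zd d) := by
  rintro ⟨i, a⟩ ⟨j, b⟩ h
  have hi := congrFun h i
  simp only [stp, Pi.single_eq_same] at hi
  have hij : i = j := by
    by_contra hne
    rw [Pi.single_eq_of_ne hne] at hi
    cases a <;> simp at hi
  subst hij
  simp only [Pi.single_eq_same] at hi
  cases a <;> cases b <;> simp_all

theorem isNN_stp {d : ℕ} (x : Zd d) (s : Fin d × Bool) : IsNN x (x + stp s) := by
  unfold IsNN
  rw [Finset.sum_eq_single s.1]
  · simp only [stp, Pi.add_apply, Pi.single_eq_same]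
    split_ifs <;> simp
  · intro j _ hj
    simp [stp, Pi.single_eq_of_ne hj]
  · simp

/-- Conditional expectation of `f` given that the path agrees with `w` up to time `T`,
for a functional depending on the first `T + k` steps. -/
def ev {d : ℕ} : ℕ → ℕ → (ℕ → Zd d) → ((ℕ → Zd d) → ℝ) → ℝ
  | 0, _, w, f => f w
  | k + 1, T, w, f => (1 / (2 * (d : ℝ))) *
      ∑ s : Fin d × Bool, ev k (T + 1) (Function.update w (T + 1) (w T + stp s)) f

/-- Cylinder. -/
def cyl {d : ℕ} (T : ℕ) (w : ℕ → Zd d) : Set (ℕ → Zd d) := {ω | ∀ t ≤ T, ω t = w t}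

theorem measurableSet_cyl {d : ℕ} (T : ℕ) (w : ℕ → Zd d) : MeasurableSet (cyl T w) := by
  have : cyl T w = ⋂ t ∈ Finset.range (T + 1), (fun ω : ℕ → Zd d => ω t) ⁻¹' {w t} := by
    ext ω; simp [cyl]
  rw [this]
  exact Finset.measurableSet_biInter _ fun t _ =>
    (measurable_pi_apply t) (measurableSet_singleton _)

theorem cyl_update {d : ℕ} {T : ℕ} {w ω : ℕ → Zd d} {v : Zd d} :
    ω ∈ cyl (T + 1) (Function.update w (T + 1) v) ↔ ω ∈ cyl T w ∧ ω (T + 1) = v := by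
  constructor
  · intro h
    refine ⟨fun t ht => ?_, ?_⟩
    · rw [h t (by omega), Function.update_of_ne (by omega)]
    · rw [h _ le_rfl, Function.update_self]
  · rintro ⟨h1, h2⟩ t ht
    rcases Nat.lt_or_ge T t with h | h
    · have : t = T + 1 := by omega
      subst this
      rw [h2, Function.update_self]
    · rw [h1 t h, Function.update_of_ne (by omega)]

theorem ev_link {d : ℕ} (hd : 0 < d) {x : Zd d} {P : Measure (ℕ → Zd d)} (hP : IsSRW d x P) :
    ∀ (k T : ℕ) (w : ℕ → Zd d) (f : (ℕ → Zd d) → ℝ),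
      (w 0 = x ∧ ∀ t < T, IsNN (w t) (w (t + 1))) →
      (∀ ω ω' : ℕ → Zd d, (∀ t ≤ T + k, ω t = ω' t) → f ω = f ω') →
      IntegrableOn f (cyl T w) P ∧
        ∫ ω in cyl T w, f ω ∂P = (1 / (2 * (d : ℝ))) ^ T * ev k T w f := by
  have hprob := hP.1
  have hcyl : ∀ (T : ℕ) (w : ℕ → Zd d), (w 0 = x ∧ ∀ t < T, IsNN (w t) (w (t + 1))) →
      P (cyl T w) = (((2 * d : ℕ) : ℝ≥0∞))⁻¹ ^ T := by
    intro T w hw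
    have := hP.2 T w
    rw [if_pos hw] at this
    exact this
  intro k
  induction k with
  | zero =>
    intro T w f hw hf
    have hEq : Set.EqOn f (fun _ => f w) (cyl T w) := fun ω hω => hf ω w (fun t ht => hω t (by omega))
    constructor
    · rw [integrableOn_congr_fun hEq (measurableSet_cyl T w)]
      exact integrableOn_const
    · rw [setIntegral_congr_fun (measurableSet_cyl T w) hEq, setIntegral_const]
      simp only [ev, smul_eq_mul]
      congr 1
      rw [measureReal_def, hcyl T w hw]
      simp
  | succ k ih =>
    intro T w f hw hf
    set W : Fin d × Bool → ℕ → Zd d :=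
      fun s => Function.update w (T + 1) (w T + stp s) with hW
    have hWv : ∀ s, (W s 0 = x ∧ ∀ t < T + 1, IsNN (W s t) (W s (t + 1))) := by
      intro s
      refine ⟨by simp [hW, Function.update_of_ne, hw.1], ?_⟩
      intro t ht
      rcases Nat.lt_or_ge t T with h | h
      · rw [hW]; simp only
        rw [Function.update_of_ne (by omega), Function.update_of_ne (by omega)]
        exact hw.2 t h
      · have : t = T := by omega
        subst this
        rw [hW]; simp only
        rw [Function.update_of_ne (by omega), Function.update_self]
        exact isNN_stp _ _
    have hih := fun s => ih (T + 1) (W s) f (hWv s) (fun ω ω' h => hf ω ω'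
      (fun t ht => h t (by omega)))
    have hdisj : Pairwise (Function.onFun Disjoint fun s => cyl (T + 1) (W s)) := by
      intro s s' hss
      rw [Function.onFun, Set.disjoint_left]
      intro ω h1 h2
      rw [cyl_update] at h1 h2
      apply hss
      apply stp_injective
      have := h1.2.symm.trans h2.2
      exact add_left_cancel this
    have hsub : (⋃ s, cyl (T + 1) (W s)) ⊆ cyl T w := by
      intro ω hω
      rw [Set.mem_iUnion] at hω
      obtain ⟨s, hs⟩ := hω
      exact (cyl_update.1 hs).1
    have hmeas : P (⋃ s, cyl (T + 1) (W s)) = P (cyl T w) := by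
      rw [measure_iUnion hdisj (fun s => measurableSet_cyl _ _), tsum_fintype,
        Finset.sum_congr rfl (fun s _ => hcyl (T + 1) (W s) (hWv s)), hcyl T w hw]
      simp only [Finset.sum_const, Finset.card_univ, Fintype.card_prod, Fintype.card_fin,
        Fintype.card_bool, nsmul_eq_mul, pow_succ]
      rw [mul_comm d 2, mul_comm (_ ^ T), ← mul_assoc, ENNReal.mul_inv_cancel, one_mul]
      · simp; omega
      · exact ENNReal.natCast_ne_top _
    have hae : (⋃ s, cyl (T + 1) (W s)) =ᵐ[P] cyl T w :=
      ae_eq_of_subset_of_measure_ge hsub hmeas.ge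
        (MeasurableSet.iUnion fun s => measurableSet_cyl _ _).nullMeasurableSet
        (measure_ne_top _ _)
    have hInteg : IntegrableOn f (⋃ s, cyl (T + 1) (W s)) P :=
      integrableOn_finite_iUnion.2 fun s => (hih s).1
    constructor
    · exact hInteg.congr_set_ae hae.symm
    · rw [← setIntegral_congr_set hae,
        integral_iUnion_fintype (fun s => measurableSet_cyl _ _) hdisj (fun s => (hih s).1),
        Finset.sum_congr rfl (fun s _ => (hih s).2)]
      simp only [ev, hW, ← Finset.mul_sum, pow_succ]
      ring

theorem integral_eq_ev {d : ℕ} (hd : 0 < d) {x : Zd d} {P : Measure (ℕ → Zd d)}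
    (hP : IsSRW d x P) (k : ℕ) (f : (ℕ → Zd d) → ℝ)
    (hf : ∀ ω ω' : ℕ → Zd d, (∀ t ≤ k, ω t = ω' t) → f ω = f ω') :
    ∫ ω, f ω ∂P = ev k 0 (fun _ => x) f := by
  have hprob := hP.1
  have h := (ev_link hd hP k 0 (fun _ => x) f ⟨rfl, by simp⟩ (by simpa using hf)).2
  have h1 : P (cyl 0 (fun _ => x)) = 1 := by
    have := hP.2 0 (fun _ => x)
    rw [if_pos ⟨rfl, by simp⟩] at this
    simpa [cyl] using this
  have h2 : (cyl 0 (fun _ => x) : Set (ℕ → Zd d)) =ᵐ[P] Set.univ := by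
    apply ae_eq_of_subset_of_measure_ge (Set.subset_univ _) _
      (measurableSet_cyl _ _).nullMeasurableSet (measure_ne_top _ _)
    rw [h1]; simp
  rw [setIntegral_congr_set h2] at h
  simpa using h

/-! ### Elementary properties of `ev` and `Pop` -/

theorem ev_mono {d : ℕ} : ∀ (k T : ℕ) (w : ℕ → Zd d) (f g : (ℕ → Zd d) → ℝ),
    (∀ ω ∈ cyl T w, f ω ≤ g ω) → ev k T w f ≤ ev k T w g := by
  intro k
  induction k with
  | zero => intro T w f g h; exact h w (fun _ _ => rfl)
  | succ k ih =>
    intro T w f g h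
    simp only [ev]
    gcongr with s _
    exact ih _ _ _ _ fun ω hω => h ω (cyl_update.1 hω).1

theorem ev_congr {d : ℕ} (k T : ℕ) (w : ℕ → Zd d) (f g : (ℕ → Zd d) → ℝ)
    (h : ∀ ω ∈ cyl T w, f ω = g ω) : ev k T w f = ev k T w g :=
  le_antisymm (ev_mono _ _ _ _ _ fun ω hω => (h ω hω).le)
    (ev_mono _ _ _ _ _ fun ω hω => (h ω hω).ge)

theorem ev_add {d : ℕ} : ∀ (k T : ℕ) (w : ℕ → Zd d) (f g : (ℕ → Zd d) → ℝ),
    ev k T w (fun ω => f ω + g ω) = ev k T w f + ev k T w g := by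
  intro k
  induction k with
  | zero => intros; rfl
  | succ k ih => intros; simp only [ev, ih, Finset.sum_add_distrib, mul_add]

theorem ev_mul {d : ℕ} : ∀ (k T : ℕ) (w : ℕ → Zd d) (c : ℝ) (f : (ℕ → Zd d) → ℝ),
    ev k T w (fun ω => c * f ω) = c * ev k T w f := by
  intro k
  induction k with
  | zero => intros; rfl
  | succ k ih => intros; simp only [ev, ih, ← Finset.mul_sum]; ring

theorem two_d_ne {d : ℕ} (hd : 0 < d) : (2 * (d : ℝ)) ≠ 0 := by positivity

theorem ev_const {d : ℕ} (hd : 0 < d) : ∀ (k T : ℕ) (w : ℕ → Zd d) (c : ℝ),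
    ev k T w (fun _ => c) = c := by
  intro k
  induction k with
  | zero => intros; rfl
  | succ k ih =>
    intros
    simp only [ev, ih]
    have := two_d_ne hd
    simp
    field_simp

theorem ev_sum {d : ℕ} (hd : 0 < d) {ι : Type*} (F : Finset ι) (k T : ℕ) (w : ℕ → Zd d)
    (f : ι → (ℕ → Zd d) → ℝ) :
    ev k T w (fun ω => ∑ i ∈ F, f i ω) = ∑ i ∈ F, ev k T w (f i) := by
  induction F using Finset.induction_on with
  | empty => simpa using ev_const hd k T w 0
  | insert a F ha ih =>
    simp only [Finset.sum_insert ha]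
    rw [ev_add, ih]

/-- Tower property. -/
theorem ev_tower {d : ℕ} : ∀ (k l T : ℕ) (w : ℕ → Zd d) (f : (ℕ → Zd d) → ℝ),
    ev (k + l) T w f = ev k T w (fun ω => ev l (T + k) ω f) := by
  intro k
  induction k with
  | zero => intro l T w f; simp [ev]
  | succ k ih =>
    intro l T w f
    rw [show k + 1 + l = (k + l) + 1 by ring]
    simp only [ev, ih]
    simp only [show T + (k + 1) = T + 1 + k by ring]

theorem Pop_mono {d : ℕ} {f g : Zd d → ℝ} (h : ∀ x, f x ≤ g x) (x : Zd d) :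
    Pop d f x ≤ Pop d g x := by
  simp only [Pop_apply]
  gcongr with s _
  exact h _

theorem pow_succ_apply {d : ℕ} (k : ℕ) (f : Zd d → ℝ) :
    (Pop d ^ (k + 1)) f = Pop d ((Pop d ^ k) f) := by
  rw [pow_succ', Module.End.mul_apply]

theorem PopPow_mono {d : ℕ} (k : ℕ) {f g : Zd d → ℝ} (h : ∀ x, f x ≤ g x) :
    ∀ x : Zd d, (Pop d ^ k) f x ≤ (Pop d ^ k) g x := by
  induction k with
  | zero => simpa using h
  | succ k ih => intro x; rw [pow_succ_apply, pow_succ_apply]; exact Pop_mono ih x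

theorem PopPow_nonneg {d : ℕ} (k : ℕ) {f : Zd d → ℝ} (h : ∀ x, 0 ≤ f x) (x : Zd d) :
    0 ≤ (Pop d ^ k) f x := by
  have := PopPow_mono k (f := 0) (g := f) h x
  simpa using this

theorem ev_pop {d : ℕ} : ∀ (k T : ℕ) (w : ℕ → Zd d) (g : Zd d → ℝ),
    ev k T w (fun ω => g (ω (T + k))) = (Pop d ^ k) g (w T) := by
  intro k
  induction k with
  | zero => intros; simp [ev]
  | succ k ih =>
    intro T w g
    rw [pow_succ_apply, Pop_apply]
    simp only [ev]
    congr 1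
    refine Finset.sum_congr rfl fun s _ => ?_
    have := ih (T + 1) (Function.update w (T + 1) (w T + stp s)) g
    rw [Function.update_self] at this
    rw [← this]
    congr 1
    funext ω
    rw [show T + (k + 1) = T + 1 + k by ring]

theorem Pop_const {d : ℕ} (hd : 0 < d) (c : ℝ) : Pop d (fun _ => c) = fun _ => c := by
  funext x
  rw [Pop_apply]
  have := two_d_ne hd
  simp
  field_simp

theorem PopPow_const {d : ℕ} (hd : 0 < d) (c : ℝ) (k : ℕ) :
    (Pop d ^ k) (fun _ => c) = fun _ => c := by
  induction k with
  | zero => simp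
  | succ k ih => rw [pow_succ_apply, ih, Pop_const hd]

theorem PopPow_translate {d : ℕ} (k : ℕ) (f : Zd d → ℝ) (z : Zd d) :
    ∀ x, (Pop d ^ k) (fun y => f (y - z)) x = (Pop d ^ k) f (x - z) := by
  induction k with
  | zero => simp
  | succ k ih =>
    intro x
    rw [pow_succ_apply, pow_succ_apply, Pop_apply, Pop_apply]
    congr 1
    refine Finset.sum_congr rfl fun s _ => ?_
    rw [ih, add_sub_right_comm]

/-! ### Finite support and sums -/

theorem Pop_fs {d : ℕ} {f : Zd d → ℝ} (hf : f.support.Finite) : (Pop d f).support.Finite := by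
  have : (Pop d f).support ⊆ ⋃ s : Fin d × Bool, (fun x => x + stp s) ⁻¹' f.support := by
    intro x hx
    rw [Set.mem_iUnion]
    by_contra hcon
    push Not at hcon
    apply hx
    rw [Pop_apply, Finset.sum_eq_zero, mul_zero]
    intro s _
    simpa using hcon s
  refine Set.Finite.subset (Set.finite_iUnion fun s => ?_) this
  exact hf.preimage ((add_left_injective _).injOn)

theorem PopPow_fs {d : ℕ} {f : Zd d → ℝ} (hf : f.support.Finite) (k : ℕ) :
    ((Pop d ^ k) f).support.Finite := by
  induction k with
  | zero => simpa using hf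
  | succ k ih => rw [pow_succ_apply]; exact Pop_fs ih

theorem fs_summable {d : ℕ} {f : Zd d → ℝ} (hf : f.support.Finite) : Summable f :=
  summable_of_hasFiniteSupport hf

/-- Self-adjointness. -/
theorem tsum_Pop_mul {d : ℕ} {f g : Zd d → ℝ} (hg : g.support.Finite) :
    ∑' x, f x * Pop d g x = ∑' x, Pop d f x * g x := by
  have hs : ∀ s : Fin d × Bool, (Function.support fun x => f x * g (x + stp s)).Finite := by
    intro s
    refine Set.Finite.subset (hg.preimage ((add_left_injective (stp s)).injOn)) ?_
    intro x hx
    simp only [Function.mem_support, Set.mem_preimage] at hx ⊢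
    exact right_ne_zero_of_mul hx
  have hs2 : ∀ s : Fin d × Bool, (Function.support fun x => f (x + stp s) * g x).Finite := by
    intro s
    refine Set.Finite.subset hg ?_
    intro x hx
    exact right_ne_zero_of_mul hx
  have e1 : (fun x => f x * Pop d g x) =
      fun x => (1 / (2 * (d : ℝ))) * ∑ s : Fin d × Bool, f x * g (x + stp s) := by
    funext x; rw [Pop_apply, ← Finset.mul_sum]; ring
  have e2 : (fun x => Pop d f x * g x) =
      fun x => (1 / (2 * (d : ℝ))) * ∑ s : Fin d × Bool, f (x + stp s) * g x := by
    funext x; rw [Pop_apply, ← Finset.sum_mul]; ring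
  rw [e1, e2, tsum_mul_left, tsum_mul_left]
  congr 1
  rw [Summable.tsum_finsetSum (fun s _ => fs_summable (hs s)),
    Summable.tsum_finsetSum (fun s _ => fs_summable (hs2 s))]
  let neg : Fin d × Bool ≃ Fin d × Bool := Equiv.prodCongr (Equiv.refl _) Equiv.boolNot
  have hneg : ∀ s, stp (neg s) = - stp s := by
    rintro ⟨i, b⟩
    cases b <;> simp [neg, stp, ← Pi.single_neg]
  rw [← Equiv.sum_comp neg]
  refine Finset.sum_congr rfl fun s _ => ?_
  rw [← Equiv.tsum_eq (Equiv.addRight (stp s))]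
  refine tsum_congr fun x => ?_
  rw [hneg]
  simp

theorem tsum_PopPow_mul {d : ℕ} (k : ℕ) : ∀ {f g : Zd d → ℝ}, g.support.Finite →
    ∑' x, f x * (Pop d ^ k) g x = ∑' x, (Pop d ^ k) f x * g x := by
  induction k with
  | zero => intros; simp
  | succ k ih =>
    intro f g hg
    rw [pow_succ_apply, tsum_Pop_mul (PopPow_fs hg k), ih hg, pow_succ, Module.End.mul_apply]

theorem tsum_PopPow {d : ℕ} (hd : 0 < d) (k : ℕ) {g : Zd d → ℝ} (hg : g.support.Finite) :
    ∑' x, (Pop d ^ k) g x = ∑' x, g x := by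
  have := tsum_PopPow_mul k (f := fun _ => 1) hg
  rw [PopPow_const hd] at this
  simpa using this

/-- Point mass. -/
def dl {d : ℕ} : Zd d → ℝ := fun x => if x = 0 then 1 else 0

theorem dl_fs {d : ℕ} : (dl : Zd d → ℝ).support.Finite := by
  refine (Set.finite_singleton 0).subset ?_
  intro x hx
  by_contra h
  apply hx
  simp only [Set.mem_singleton_iff] at h
  simp [dl, h]

theorem dl_nonneg {d : ℕ} (x : Zd d) : 0 ≤ dl x := by unfold dl; split_ifs <;> norm_num

theorem tsum_dl {d : ℕ} : ∑' x : Zd d, dl x = 1 := by simp [dl]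

/-- Expansion of `Pop^k g` through the kernel. -/
theorem PopPow_le_of_kernel {d : ℕ} (k : ℕ) (b : ℝ) (hb : ∀ x : Zd d, (Pop d ^ k) dl x ≤ b)
    {g : Zd d → ℝ} (hg : g.support.Finite) (hg0 : ∀ x, 0 ≤ g x) (y : Zd d) :
    (Pop d ^ k) g y ≤ b * ∑' x, g x := by
  have hdec : g = ∑ z ∈ hg.toFinset, g z • fun x => dl (x - z) := by
    funext x
    simp only [Finset.sum_apply, Pi.smul_apply, smul_eq_mul, dl, sub_eq_zero]
    by_cases hx : g x = 0
    · rw [hx]; symm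
      apply Finset.sum_eq_zero
      intro z hz
      split_ifs with h
      · subst h; simp at hz; contradiction
      · simp
    · simp [hx]
  rw [tsum_eq_sum (s := hg.toFinset) (by intro x hx; simpa using hx)]
  conv_lhs => rw [hdec]
  rw [map_sum, Finset.sum_apply, Finset.mul_sum]
  refine Finset.sum_le_sum fun z _ => ?_
  rw [map_smul, Pi.smul_apply, PopPow_translate, smul_eq_mul, mul_comm]
  exact mul_le_mul_of_nonneg_right (hb _) (hg0 z)


/-! ### Heat kernel upper bound through Fourier analysis -/

/-- Lebesgue measure on `(0, π]`. -/
def nu : Measure ℝ := volume.restrict (Set.Ioc 0 Real.pi)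

/-- Product measure on the box. -/
def boxm (d : ℕ) : Measure (Fin d → ℝ) := Measure.pi fun _ => nu

instance : IsFiniteMeasure nu := by
  unfold nu
  refine ⟨?_⟩
  simp

instance (d : ℕ) : IsFiniteMeasure (boxm d) := by
  unfold boxm
  infer_instance

/-- Characteristic function of one step. -/
def chf {d : ℕ} (θ : Fin d → ℝ) : ℝ := (1 / (d : ℝ)) * ∑ i, Real.cos (θ i)

theorem chf_sq_le {d : ℕ} (hd : 0 < d) (θ : Fin d → ℝ) :
    chf θ ^ 2 ≤ Real.exp (-((1 / (d : ℝ)) * ∑ i, Real.sin (θ i) ^ 2)) := by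
  have hd' : (0 : ℝ) < d := by exact_mod_cast hd
  have h1 : (∑ i, Real.cos (θ i)) ^ 2 ≤ d * ∑ i, Real.cos (θ i) ^ 2 := by
    have := sq_sum_le_card_mul_sum_sq (s := Finset.univ) (f := fun i : Fin d => Real.cos (θ i))
    simpa using this
  have h2 : ∑ i, Real.cos (θ i) ^ 2 = d - ∑ i, Real.sin (θ i) ^ 2 := by
    simp only [Real.cos_sq']
    simp [Finset.sum_sub_distrib]
  have h3 : chf θ ^ 2 ≤ 1 - (1 / (d : ℝ)) * ∑ i, Real.sin (θ i) ^ 2 := by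
    unfold chf
    rw [mul_pow]
    calc (1 / (d : ℝ)) ^ 2 * (∑ i, Real.cos (θ i)) ^ 2
        ≤ (1 / (d : ℝ)) ^ 2 * (d * ∑ i, Real.cos (θ i) ^ 2) := by gcongr
      _ = 1 - (1 / (d : ℝ)) * ∑ i, Real.sin (θ i) ^ 2 := by
        rw [h2]; field_simp
  have h4 := Real.add_one_le_exp (-((1 / (d : ℝ)) * ∑ i, Real.sin (θ i) ^ 2))
  linarith

theorem chf_abs_le {d : ℕ} (hd : 0 < d) (θ : Fin d → ℝ) : |chf θ| ≤ 1 := by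
  have h := chf_sq_le hd θ
  have h2 : Real.exp (-((1 / (d : ℝ)) * ∑ i, Real.sin (θ i) ^ 2)) ≤ 1 := by
    rw [Real.exp_le_one_iff]
    have : 0 ≤ (1 / (d : ℝ)) * ∑ i, Real.sin (θ i) ^ 2 :=
      mul_nonneg (by positivity) (Finset.sum_nonneg fun i _ => sq_nonneg _)
    linarith
  rw [← sq_le_one_iff_abs_le_one]
  linarith

theorem continuous_chf {d : ℕ} : Continuous (chf : (Fin d → ℝ) → ℝ) := by
  unfold chf
  fun_prop

theorem prod_cos_abs_le {d : ℕ} (x : Zd d) (θ : Fin d → ℝ) :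
    |∏ i, Real.cos ((x i : ℝ) * θ i)| ≤ 1 := by
  rw [Finset.abs_prod]
  exact Finset.prod_le_one (fun i _ => abs_nonneg _) fun i _ => Real.abs_cos_le_one _

theorem four_integrand_abs {d : ℕ} (hd : 0 < d) (t : ℕ) (x : Zd d) (θ : Fin d → ℝ) :
    |chf θ ^ t * ∏ i, Real.cos ((x i : ℝ) * θ i)| ≤ |chf θ| ^ t := by
  rw [abs_mul, abs_pow]
  exact mul_le_of_le_one_right (by positivity) (prod_cos_abs_le x θ)

theorem four_integrable {d : ℕ} (hd : 0 < d) (t : ℕ) (x : Zd d) :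
    Integrable (fun θ : Fin d → ℝ => chf θ ^ t * ∏ i, Real.cos ((x i : ℝ) * θ i)) (boxm d) := by
  refine Integrable.of_bound (C := 1) ?_ ?_
  · apply Continuous.aestronglyMeasurable
    have := continuous_chf (d := d)
    fun_prop
  · refine Filter.Eventually.of_forall fun θ => ?_
    rw [Real.norm_eq_abs]
    exact (four_integrand_abs hd t x θ).trans (pow_le_one₀ (abs_nonneg _) (chf_abs_le hd θ))

theorem integral_cos_int (n : ℤ) :
    ∫ θ, Real.cos ((n : ℝ) * θ) ∂nu = if n = 0 then Real.pi else 0 := by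
  unfold nu
  rw [← intervalIntegral.integral_of_le Real.pi_pos.le]
  split_ifs with h
  · simp [h]
  · rw [intervalIntegral.integral_comp_mul_left (fun y => Real.cos y) (by exact_mod_cast h)]
    simp

theorem step_identity {d : ℕ} (hd : 0 < d) (x : Zd d) (θ : Fin d → ℝ) :
    (1 / (2 * (d : ℝ))) * ∑ s : Fin d × Bool, ∏ i, Real.cos (((x + stp s) i : ℤ) * θ i) =
      chf θ * ∏ i, Real.cos ((x i : ℝ) * θ i) := by
  have key : ∀ s : Fin d × Bool, ∏ i, Real.cos (((x + stp s) i : ℤ) * θ i) =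
      Real.cos (((x s.1 : ℝ) + (if s.2 then 1 else -1)) * θ s.1) *
        ∏ j ∈ Finset.univ.erase s.1, Real.cos ((x j : ℝ) * θ j) := by
    intro s
    rw [← Finset.mul_prod_erase Finset.univ _ (Finset.mem_univ s.1)]
    congr 1
    · simp only [stp, Pi.add_apply, Pi.single_eq_same]
      push_cast
      congr 2
    · refine Finset.prod_congr rfl fun j hj => ?_
      have : j ≠ s.1 := Finset.ne_of_mem_erase hj
      simp [stp, Pi.single_eq_of_ne this]
  simp only [key, Fintype.sum_prod_type, Fintype.sum_bool, if_true, Bool.false_eq_true, if_false]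
  unfold chf
  have : ∀ i : Fin d, Real.cos (((x i : ℝ) + 1) * θ i) *
        ∏ j ∈ Finset.univ.erase i, Real.cos ((x j : ℝ) * θ j) +
      Real.cos (((x i : ℝ) + -1) * θ i) *
        ∏ j ∈ Finset.univ.erase i, Real.cos ((x j : ℝ) * θ j) =
      2 * Real.cos (θ i) * ∏ j, Real.cos ((x j : ℝ) * θ j) := by
    intro i
    rw [← Finset.mul_prod_erase Finset.univ (fun j => Real.cos ((x j : ℝ) * θ j))
      (Finset.mem_univ i)]
    rw [add_mul, add_mul, Real.cos_add, Real.cos_add]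
    simp only [one_mul, neg_mul, Real.cos_neg, Real.sin_neg]
    ring
  rw [Finset.sum_congr rfl fun i _ => this i, ← Finset.sum_mul, ← Finset.mul_sum]
  have hd' : (d : ℝ) ≠ 0 := by positivity
  field_simp

theorem fourier_repr {d : ℕ} (hd : 0 < d) (t : ℕ) : ∀ x : Zd d,
    ∫ θ, chf θ ^ t * ∏ i, Real.cos ((x i : ℝ) * θ i) ∂(boxm d) =
      Real.pi ^ d * (Pop d ^ t) dl x := by
  induction t with
  | zero =>
    intro x
    simp only [pow_zero, one_mul, Module.End.one_apply]
    unfold boxm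
    rw [integral_fintype_prod_eq_prod (fun i (θ : ℝ) => Real.cos ((x i : ℝ) * θ))]
    simp only [integral_cos_int]
    unfold dl
    split_ifs with h
    · simp [h]
    · have : ∃ i, x i ≠ 0 := by
        by_contra hcon
        push Not at hcon
        exact h (funext hcon)
      obtain ⟨i, hi⟩ := this
      rw [mul_zero]
      exact Finset.prod_eq_zero (Finset.mem_univ i) (by simp [hi])
  | succ t ih =>
    intro x
    rw [pow_succ_apply, Pop_apply, ← mul_assoc, mul_comm (Real.pi ^ d), mul_assoc,
      Finset.mul_sum, ← Finset.sum_congr rfl fun s _ => ih (x + stp s),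
      ← integral_finset_sum _ fun s _ => four_integrable hd t (x + stp s),
      ← integral_const_mul]
    refine integral_congr_ae (Filter.Eventually.of_forall fun θ => ?_)
    simp only
    rw [← Finset.mul_sum, pow_succ, mul_assoc, ← step_identity hd]
    ring

theorem exp_sin_le {a θ : ℝ} (ha : 0 < a) (h0 : 0 ≤ θ) (h1 : θ ≤ Real.pi) :
    Real.exp (-a * Real.sin θ ^ 2) ≤
      Real.exp (-(4 * a / Real.pi ^ 2) * θ ^ 2) +
        Real.exp (-(4 * a / Real.pi ^ 2) * (θ - Real.pi) ^ 2) := by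
  have hpi := Real.pi_pos
  rcases le_total θ (Real.pi / 2) with h | h
  · have hs := Real.mul_le_sin h0 h
    have : (2 / Real.pi * θ) ^ 2 ≤ Real.sin θ ^ 2 := by
      apply pow_le_pow_left₀ (by positivity) hs
    have h3 : Real.exp (-a * Real.sin θ ^ 2) ≤ Real.exp (-(4 * a / Real.pi ^ 2) * θ ^ 2) := by
      apply Real.exp_le_exp.2
      have e : -(4 * a / Real.pi ^ 2) * θ ^ 2 = -a * (2 / Real.pi * θ) ^ 2 := by
        field_simp; ring
      rw [e]
      nlinarith
    have := Real.exp_pos (-(4 * a / Real.pi ^ 2) * (θ - Real.pi) ^ 2)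
    linarith
  · have hs := Real.mul_le_sin (x := Real.pi - θ) (by linarith) (by linarith)
    rw [Real.sin_pi_sub] at hs
    have : (2 / Real.pi * (Real.pi - θ)) ^ 2 ≤ Real.sin θ ^ 2 := by
      apply pow_le_pow_left₀ _ hs
      apply mul_nonneg (by positivity) (by linarith)
    have h3 : Real.exp (-a * Real.sin θ ^ 2) ≤
        Real.exp (-(4 * a / Real.pi ^ 2) * (θ - Real.pi) ^ 2) := by
      apply Real.exp_le_exp.2
      have e : -(4 * a / Real.pi ^ 2) * (θ - Real.pi) ^ 2 =
          -a * (2 / Real.pi * (Real.pi - θ)) ^ 2 := by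
        field_simp; ring
      rw [e]
      nlinarith
    have := Real.exp_pos (-(4 * a / Real.pi ^ 2) * θ ^ 2)
    linarith

theorem integral_exp_sin_le {a : ℝ} (ha : 0 < a) :
    ∫ θ, Real.exp (-a * Real.sin θ ^ 2) ∂nu ≤ Real.sqrt (Real.pi ^ 3 / a) := by
  have hpi := Real.pi_pos
  set b := 4 * a / Real.pi ^ 2 with hb
  have hbpos : 0 < b := by positivity
  have hi1 : Integrable (fun θ : ℝ => Real.exp (-b * θ ^ 2)) volume :=
    integrable_exp_neg_mul_sq hbpos
  have hi2 : Integrable (fun θ : ℝ => Real.exp (-b * (θ - Real.pi) ^ 2)) volume :=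
    hi1.comp_sub_right Real.pi
  have h1 : ∫ θ, Real.exp (-a * Real.sin θ ^ 2) ∂nu ≤
      ∫ θ, (Real.exp (-b * θ ^ 2) + Real.exp (-b * (θ - Real.pi) ^ 2)) ∂nu := by
    unfold nu
    refine setIntegral_mono_on ?_ (hi1.add hi2).integrableOn measurableSet_Ioc ?_
    · refine Continuous.integrableOn_Ioc ?_
      fun_prop
    · intro θ hθ
      exact exp_sin_le ha hθ.1.le hθ.2
  have h2 : ∫ θ, (Real.exp (-b * θ ^ 2) + Real.exp (-b * (θ - Real.pi) ^ 2)) ∂nu ≤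
      ∫ θ, (Real.exp (-b * θ ^ 2) + Real.exp (-b * (θ - Real.pi) ^ 2)) := by
    unfold nu
    refine setIntegral_le_integral (hi1.add hi2) (Filter.Eventually.of_forall fun θ => ?_)
    simp only [Pi.zero_apply]
    positivity
  have h3 : ∫ θ, (Real.exp (-b * θ ^ 2) + Real.exp (-b * (θ - Real.pi) ^ 2)) =
      2 * Real.sqrt (Real.pi / b) := by
    rw [integral_add hi1 hi2,
      integral_sub_right_eq_self (fun θ : ℝ => Real.exp (-b * θ ^ 2)) Real.pi, integral_gaussian]
    ring
  have h4 : 2 * Real.sqrt (Real.pi / b) = Real.sqrt (Real.pi ^ 3 / a) := by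
    have : Real.pi ^ 3 / a = 2 ^ 2 * (Real.pi / b) := by
      rw [hb]; field_simp; ring
    rw [this, Real.sqrt_mul (by positivity), Real.sqrt_sq (by norm_num)]
  linarith

theorem kernel_le_one {d : ℕ} (hd : 0 < d) (t : ℕ) (x : Zd d) : (Pop d ^ t) dl x ≤ 1 := by
  have := PopPow_mono t (f := dl) (g := fun _ : Zd d => (1 : ℝ))
    (fun x => by unfold dl; split_ifs <;> norm_num) x
  rwa [PopPow_const hd] at this

/-- Heat kernel upper bound. -/
theorem kernel_le {d : ℕ} (hd : 0 < d) (t : ℕ) (ht : 0 < t) (x : Zd d) :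
    (Pop d ^ t) dl x ≤ Real.sqrt (3 * Real.pi * d / t) ^ d := by
  have hpi := Real.pi_pos
  have hd' : (0 : ℝ) < d := by exact_mod_cast hd
  have hd1 : (1 : ℝ) ≤ d := by exact_mod_cast hd
  rcases Nat.lt_or_ge t 2 with h | h
  · have : t = 1 := by omega
    subst this
    refine (kernel_le_one hd 1 x).trans ?_
    apply one_le_pow₀
    rw [Real.one_le_sqrt]
    have := Real.pi_gt_three
    rw [Nat.cast_one, div_one]
    nlinarith
  · set u := t / 2 with hu
    have hu1 : 1 ≤ u := by omega
    have hut : t ≤ 3 * u := by omega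
    have hu0 : (0 : ℝ) < u := by exact_mod_cast hu1
    have ht0 : (0 : ℝ) < t := by exact_mod_cast ht
    have hbd : ∀ θ : Fin d → ℝ, chf θ ^ t * ∏ i, Real.cos ((x i : ℝ) * θ i) ≤
        ∏ i, Real.exp (-((u : ℝ) / d) * Real.sin (θ i) ^ 2) := by
      intro θ
      calc chf θ ^ t * ∏ i, Real.cos ((x i : ℝ) * θ i)
          ≤ |chf θ| ^ t := (le_abs_self _).trans (four_integrand_abs hd t x θ)
        _ ≤ |chf θ| ^ (2 * u) :=
            pow_le_pow_of_le_one (abs_nonneg _) (chf_abs_le hd θ) (by omega)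
        _ = (chf θ ^ 2) ^ u := by rw [pow_mul, sq_abs]
        _ ≤ (Real.exp (-((1 / (d : ℝ)) * ∑ i, Real.sin (θ i) ^ 2))) ^ u :=
            pow_le_pow_left₀ (sq_nonneg _) (chf_sq_le hd θ) _
        _ = ∏ i, Real.exp (-((u : ℝ) / d) * Real.sin (θ i) ^ 2) := by
            rw [← Real.exp_nat_mul, ← Real.exp_sum, ← Finset.mul_sum]
            congr 1
            field_simp
    have hInteg : ∫ θ, chf θ ^ t * ∏ i, Real.cos ((x i : ℝ) * θ i) ∂(boxm d) ≤
        ∫ θ, ∏ i, Real.exp (-((u : ℝ) / d) * Real.sin (θ i) ^ 2) ∂(boxm d) := by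
      refine integral_mono (four_integrable hd t x) ?_ hbd
      refine Integrable.of_bound (C := 1) ?_ (Filter.Eventually.of_forall fun θ => ?_)
      · apply Continuous.aestronglyMeasurable
        fun_prop
      · rw [Real.norm_eq_abs, Finset.abs_prod]
        refine Finset.prod_le_one (fun i _ => abs_nonneg _) fun i _ => ?_
        rw [abs_of_pos (Real.exp_pos _), Real.exp_le_one_iff]
        have : 0 ≤ ((u : ℝ) / d) * Real.sin (θ i) ^ 2 := by positivity
        linarith
    rw [fourier_repr hd t x] at hInteg
    have hprod : ∫ θ, ∏ i, Real.exp (-((u : ℝ) / d) * Real.sin (θ i) ^ 2) ∂(boxm d) ≤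
        Real.sqrt (Real.pi ^ 3 / ((u : ℝ) / d)) ^ d := by
      unfold boxm
      rw [integral_fintype_prod_eq_prod
        (fun (_ : Fin d) (θ : ℝ) => Real.exp (-((u : ℝ) / d) * Real.sin θ ^ 2))]
      rw [Finset.prod_const, Finset.card_univ, Fintype.card_fin]
      exact pow_le_pow_left₀ (integral_nonneg fun θ => (Real.exp_pos _).le)
        (integral_exp_sin_le (by positivity)) _
    have hfin : Real.sqrt (Real.pi ^ 3 / ((u : ℝ) / d)) ^ d ≤
        Real.pi ^ d * Real.sqrt (3 * Real.pi * d / t) ^ d := by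
      rw [← mul_pow]
      apply pow_le_pow_left₀ (Real.sqrt_nonneg _)
      have : Real.pi * Real.sqrt (3 * Real.pi * d / t) =
          Real.sqrt (Real.pi ^ 2 * (3 * Real.pi * d / t)) := by
        rw [Real.sqrt_mul (by positivity), Real.sqrt_sq hpi.le]
      rw [this]
      apply Real.sqrt_le_sqrt
      have hut' : (t : ℝ) ≤ 3 * u := by exact_mod_cast hut
      rw [div_div_eq_mul_div, ← mul_div_assoc, div_le_div_iff₀ hu0 ht0]
      have : 0 < Real.pi ^ 3 * d := by positivity
      nlinarith
    have := hInteg.trans (hprod.trans hfin)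
    exact le_of_mul_le_mul_left this (by positivity)

/-! ### Visit counts and the case `d ≥ 5` -/

theorem sum_inv_sq_le (T N : ℕ) (hT : 0 < T) :
    ∑ j ∈ Finset.Icc T N, 1 / (j : ℝ) ^ 2 ≤ 2 / (T : ℝ) := by
  have hT' : (0 : ℝ) < T := by exact_mod_cast hT
  have key : ∀ n : ℕ, ∑ j ∈ Finset.Icc T (T + n), 1 / (j : ℝ) ^ 2 ≤
      2 / (T : ℝ) - 1 / ((T + n : ℕ) : ℝ) := by
    intro n
    induction n with
    | zero =>
      simp only [add_zero, Finset.Icc_self, Finset.sum_singleton]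
      have h1 : (1 : ℝ) ≤ T := by exact_mod_cast hT
      have : 1 / (T : ℝ) ^ 2 ≤ 1 / T := by
        apply one_div_le_one_div_of_le hT'
        nlinarith
      have e : 2 / (T : ℝ) = 1 / T + 1 / T := by ring
      linarith
    | succ n ih =>
      rw [← add_assoc, Finset.sum_Icc_succ_top (by omega)]
      have h1 : (0 : ℝ) < ((T + n : ℕ) : ℝ) := by positivity
      have h2 : 1 / (((T + n + 1 : ℕ) : ℝ)) ^ 2 ≤
          1 / ((T + n : ℕ) : ℝ) - 1 / ((T + n + 1 : ℕ) : ℝ) := by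
        push_cast at h1 ⊢
        rw [div_sub_div _ _ (by positivity) (by positivity), div_le_div_iff₀ (by positivity)
          (by positivity)]
        nlinarith
      linarith
  by_cases h : T ≤ N
  · obtain ⟨n, rfl⟩ := Nat.exists_eq_add_of_le h
    have := key n
    have h1 : (0 : ℝ) < 1 / ((T + n : ℕ) : ℝ) := by positivity
    linarith
  · rw [Finset.Icc_eq_empty h]
    simp only [Finset.sum_empty]
    positivity

theorem ev_at {d : ℕ} (hd : 0 < d) (j N : ℕ) (h : j ≤ N) (w : ℕ → Zd d) (g : Zd d → ℝ) :
    ev N 0 w (fun ω => g (ω j)) = (Pop d ^ j) g (w 0) := by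
  obtain ⟨l, rfl⟩ := Nat.exists_eq_add_of_le h
  rw [ev_tower]
  have := ev_pop j 0 w g
  rw [← this]
  refine ev_congr _ _ _ _ _ fun ω _ => ?_
  rw [ev_congr l (0 + j) ω _ (fun _ => g (ω (0 + j))), ev_const hd]
  intro ω' h'
  simp only [zero_add] at h' ⊢
  rw [h' j le_rfl]

def kc (d : ℕ) : ℝ := (3 * Real.pi * d) ^ ((d : ℝ) / 2)

theorem kc_pos {d : ℕ} (hd : 0 < d) : 0 < kc d := by
  have := Real.pi_pos
  unfold kc
  positivity

theorem kernel_rpow {d : ℕ} (hd : 0 < d) (j : ℕ) (hj : 0 < j) (x : Zd d) :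
    (Pop d ^ j) dl x ≤ kc d * (j : ℝ) ^ (-((d : ℝ) / 2)) := by
  refine (kernel_le hd j hj x).trans (le_of_eq ?_)
  have hpi := Real.pi_pos
  have hj' : (0 : ℝ) < j := by exact_mod_cast hj
  unfold kc
  rw [Real.sqrt_eq_rpow, ← Real.rpow_natCast, ← Real.rpow_mul (by positivity),
    Real.div_rpow (by positivity) (by positivity), Real.rpow_neg hj'.le, div_eq_mul_inv,
    one_div, inv_mul_eq_div]

theorem visit_le {d : ℕ} (hd : 0 < d) (j : ℕ) (hj : 0 < j) {g : Zd d → ℝ}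
    (hg : g.support.Finite) (hg0 : ∀ x, 0 ≤ g x) (y : Zd d) :
    (Pop d ^ j) g y ≤ kc d * (j : ℝ) ^ (-((d : ℝ) / 2)) * ∑' x, g x :=
  PopPow_le_of_kernel j _ (kernel_rpow hd j hj) hg hg0 y

theorem indic_fs {d : ℕ} (A : Finset (Zd d)) :
    (Function.support fun x : Zd d => if x ∈ A then (1 : ℝ) else 0).Finite := by
  refine A.finite_toSet.subset ?_
  intro x hx
  by_contra h
  apply hx
  exact if_neg h

theorem tsum_indic {d : ℕ} (A : Finset (Zd d)) :
    ∑' x : Zd d, (if x ∈ A then (1 : ℝ) else 0) = A.card := by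
  rw [tsum_eq_sum (s := A)]
  · simp
  · intro b hb; exact if_neg hb

theorem case_five {d : ℕ} (hd : 5 ≤ d) {P : Measure (ℕ → Zd d)} {y : Zd d} (hP : IsSRW d y P)
    (A : Finset (Zd d)) (T N : ℕ) (hT : 0 < T) :
    ∫ ω, ((walkRange ω T N ∩ A).card : ℝ) ∂P ≤
      (2 * kc d) * A.card * (T : ℝ) ^ ((1 : ℝ) - d / 2) := by
  have hd0 : 0 < d := by omega
  have hT' : (0 : ℝ) < T := by exact_mod_cast hT
  rw [integral_eq_ev hd0 hP N]
  · have h1 : ∀ ω : ℕ → Zd d, ((walkRange ω T N ∩ A).card : ℝ) ≤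
        ∑ j ∈ Finset.Icc T N, if ω j ∈ A then (1 : ℝ) else 0 := by
      intro ω
      have : (walkRange ω T N ∩ A) = ((Finset.Icc T N).filter fun j => ω j ∈ A).image ω := by
        ext x
        simp only [walkRange, Finset.mem_inter, Finset.mem_image, Finset.mem_filter]
        constructor
        · rintro ⟨⟨j, hj, rfl⟩, h⟩; exact ⟨j, ⟨hj, h⟩, rfl⟩
        · rintro ⟨j, ⟨hj, h⟩, rfl⟩; exact ⟨⟨j, hj, rfl⟩, h⟩
      rw [this]
      rw [← Finset.sum_filter, Finset.sum_const, nsmul_eq_mul, mul_one]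
      exact_mod_cast Finset.card_image_le
    refine (ev_mono _ _ _ _ _ fun ω _ => h1 ω).trans ?_
    rw [ev_sum hd0]
    have h2 : ∀ j ∈ Finset.Icc T N,
        ev N 0 (fun _ => y) (fun ω => if ω j ∈ A then (1 : ℝ) else 0) ≤
          kc d * A.card * (T : ℝ) ^ ((2 : ℝ) - d / 2) * (1 / (j : ℝ) ^ 2) := by
      intro j hj
      rw [Finset.mem_Icc] at hj
      have hj0 : 0 < j := by omega
      have hj' : (0 : ℝ) < j := by exact_mod_cast hj0
      rw [ev_at hd0 j N hj.2 _ (fun x => if x ∈ A then (1 : ℝ) else 0)]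
      refine (visit_le hd0 j hj0 (indic_fs A) (fun x => by split_ifs <;> norm_num) y).trans ?_
      rw [tsum_indic]
      have h3 : (j : ℝ) ^ (-((d : ℝ) / 2)) ≤ (T : ℝ) ^ ((2 : ℝ) - d / 2) * (1 / (j : ℝ) ^ 2) := by
        have e : (j : ℝ) ^ (-((d : ℝ) / 2)) = (j : ℝ) ^ ((2 : ℝ) - d / 2) * (1 / (j : ℝ) ^ 2) := by
          rw [one_div, ← Real.rpow_natCast, ← Real.rpow_neg hj'.le, ← Real.rpow_add hj']
          congr 1; push_cast; ring
        rw [e]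
        refine mul_le_mul_of_nonneg_right ?_ (by positivity)
        apply Real.rpow_le_rpow_of_nonpos hT' (by exact_mod_cast hj.1)
        have : (5 : ℝ) ≤ d := by exact_mod_cast hd
        linarith
      have := kc_pos hd0
      calc kc d * (j : ℝ) ^ (-((d : ℝ) / 2)) * A.card
          ≤ kc d * ((T : ℝ) ^ ((2 : ℝ) - d / 2) * (1 / (j : ℝ) ^ 2)) * A.card := by gcongr
        _ = _ := by ring
    refine (Finset.sum_le_sum h2).trans ?_
    rw [← Finset.mul_sum]
    have := kc_pos hd0
    calc kc d * A.card * (T : ℝ) ^ ((2 : ℝ) - d / 2) * ∑ j ∈ Finset.Icc T N, 1 / (j : ℝ) ^ 2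
        ≤ kc d * A.card * (T : ℝ) ^ ((2 : ℝ) - d / 2) * (2 / T) := by
          gcongr; exact sum_inv_sq_le T N hT
      _ = _ := by
        have e : (T : ℝ) ^ ((2 : ℝ) - d / 2) = (T : ℝ) ^ ((1 : ℝ) - d / 2) * T := by
          rw [← Real.rpow_add_one hT'.ne']; congr 1; ring
        rw [e]; field_simp
  · intro ω ω' h
    have : walkRange ω T N = walkRange ω' T N := by
      unfold walkRange
      refine Finset.image_congr ?_
      intro t ht
      exact h t (Finset.mem_Icc.1 ht).2
    simp only [this]

/-! ### Hitting probabilities and the truncated capacity -/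

/-- Probability of hitting `S` within `k` steps. -/
def hit {d : ℕ} (S : Finset (Zd d)) : ℕ → Zd d → ℝ
  | 0 => fun z => if z ∈ S then 1 else 0
  | k + 1 => fun z => if z ∈ S then 1 else Pop d (hit S k) z

theorem Pop_le_const {d : ℕ} (hd : 0 < d) {f : Zd d → ℝ} {c : ℝ} (h : ∀ x, f x ≤ c) (x : Zd d) :
    Pop d f x ≤ c := by
  have := Pop_mono (g := fun _ => c) h x
  rwa [Pop_const hd] at this

theorem Pop_nonneg {d : ℕ} {f : Zd d → ℝ} (h : ∀ x, 0 ≤ f x) (x : Zd d) : 0 ≤ Pop d f x := by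
  have := PopPow_nonneg 1 h x
  simpa using this

theorem hit_le_one {d : ℕ} (hd : 0 < d) (S : Finset (Zd d)) (k : ℕ) :
    ∀ z, hit S k z ≤ 1 := by
  induction k with
  | zero => intro z; unfold hit; split_ifs <;> norm_num
  | succ k ih => intro z; unfold hit; split_ifs
                 · exact le_rfl
                 · exact Pop_le_const hd ih z

theorem hit_nonneg {d : ℕ} (S : Finset (Zd d)) (k : ℕ) : ∀ z, 0 ≤ hit S k z := by
  induction k with
  | zero => intro z; unfold hit; split_ifs <;> norm_num
  | succ k ih => intro z; unfold hit; split_ifs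
                 · norm_num
                 · exact Pop_nonneg ih z

theorem hit_mem {d : ℕ} {S : Finset (Zd d)} {z : Zd d} (h : z ∈ S) (k : ℕ) : hit S k z = 1 := by
  cases k <;> simp [hit, h]

theorem hit_mono_time {d : ℕ} (S : Finset (Zd d)) (k : ℕ) :
    ∀ z, hit S k z ≤ hit S (k + 1) z := by
  induction k with
  | zero =>
    intro z
    by_cases h : z ∈ S
    · rw [hit_mem h, hit_mem h]
    · have := hit_nonneg S 1 z
      simpa [hit, h] using this
  | succ k ih =>
    intro z
    by_cases h : z ∈ S
    · rw [hit_mem h, hit_mem h]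
    · simp only [hit, h, if_false]
      exact Pop_mono ih z

theorem hit_mono_set {d : ℕ} (hd : 0 < d) {S S' : Finset (Zd d)} (hS : S ⊆ S') (k : ℕ) :
    ∀ z, hit S k z ≤ hit S' k z := by
  induction k with
  | zero =>
    intro z
    by_cases h : z ∈ S
    · rw [hit_mem h, hit_mem (hS h)]
    · have := hit_nonneg S' 0 z
      simpa [hit, h] using this
  | succ k ih =>
    intro z
    by_cases h : z ∈ S'
    · rw [hit_mem h]; exact hit_le_one hd _ _ _
    · have h' : z ∉ S := fun hz => h (hS hz)
      simp only [hit, h, h', if_false]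
      exact Pop_mono ih z

theorem hit_union {d : ℕ} (S S' : Finset (Zd d)) (k : ℕ) :
    ∀ z, hit (S ∪ S') k z ≤ hit S k z + hit S' k z := by
  induction k with
  | zero =>
    intro z
    simp only [hit, Finset.mem_union]
    split_ifs <;> first | (exfalso; tauto; done) | norm_num
  | succ k ih =>
    intro z
    by_cases h : z ∈ S
    · rw [hit_mem h, hit_mem (Finset.mem_union_left _ h)]
      have := hit_nonneg S' (k + 1) z; linarith
    by_cases h' : z ∈ S'
    · rw [hit_mem h', hit_mem (Finset.mem_union_right _ h')]
      have := hit_nonneg S (k + 1) z; linarith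
    simp only [hit, h, h', Finset.mem_union, or_self, if_false]
    have e : Pop d (hit S k) z + Pop d (hit S' k) z = Pop d (hit S k + hit S' k) z := by
      rw [map_add]; rfl
    rw [e]
    exact Pop_mono ih z

theorem hit_fs {d : ℕ} (S : Finset (Zd d)) (k : ℕ) : (hit S k).support.Finite := by
  induction k with
  | zero => exact indic_fs S
  | succ k ih =>
    refine (S.finite_toSet.union (Pop_fs ih)).subset ?_
    intro z hz
    by_contra hcon
    simp only [Set.mem_union, Finset.mem_coe, Function.mem_support, not_or, not_not] at hcon
    apply hz
    simp only [hit, hcon.1, hcon.2, if_false]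

theorem ev_avoid {d : ℕ} (hd : 0 < d) (S : Finset (Zd d)) (k : ℕ) : ∀ (T : ℕ) (w : ℕ → Zd d),
    ev k T w (fun ω => if ∀ t, T ≤ t → t ≤ T + k → ω t ∉ S then (1 : ℝ) else 0) =
      1 - hit S k (w T) := by
  have h2d := two_d_ne hd
  induction k with
  | zero =>
    intro T w
    have : (∀ t, T ≤ t → t ≤ T + 0 → w t ∉ S) ↔ w T ∉ S := by
      constructor
      · intro h; exact h T le_rfl le_rfl
      · intro h t h1 h2
        have : t = T := by omega
        rwa [this]
    simp only [ev, hit, this]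
    split_ifs <;> norm_num
  | succ k ih =>
    intro T w
    by_cases hw : w T ∈ S
    · rw [hit_mem hw, ev_congr _ _ _ _ (fun _ => 0), ev_const hd]
      · norm_num
      · intro ω hω
        apply if_neg
        intro h
        apply h T le_rfl (by omega)
        rw [hω T le_rfl]; exact hw
    · simp only [hit, hw, if_false, ev, Pop_apply]
      have : ∀ s : Fin d × Bool, ev k (T + 1) (Function.update w (T + 1) (w T + stp s))
          (fun ω => if ∀ t, T ≤ t → t ≤ T + (k + 1) → ω t ∉ S then (1 : ℝ) else 0) =
          1 - hit S k (w T + stp s) := by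
        intro s
        have h1 := ih (T + 1) (Function.update w (T + 1) (w T + stp s))
        rw [Function.update_self] at h1
        rw [← h1]
        refine ev_congr _ _ _ _ _ fun ω hω => ?_
        rw [cyl_update] at hω
        congr 1
        apply propext
        constructor
        · intro h t h1 h2; exact h t (by omega) (by omega)
        · intro h t h1 h2
          rcases Nat.eq_or_lt_of_le h1 with h3 | h3
          · rw [← h3, hω.1 T le_rfl]; exact hw
          · exact h t (by omega) (by omega)
      simp only [this, Finset.sum_sub_distrib, Finset.sum_const, Finset.card_univ,
        Fintype.card_prod, Fintype.card_fin, Fintype.card_bool, nsmul_eq_mul]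
      push_cast
      field_simp

theorem noReturn_eq {d : ℕ} (hd : 0 < d) {x : Zd d} {P : Measure (ℕ → Zd d)} (hP : IsSRW d x P)
    (S : Finset (Zd d)) (s : ℝ) (k : ℕ) (hk : ⌊s⌋₊ = k + 1) :
    (P (NoReturnUpTo (↑S) s)).toReal = 1 - Pop d (hit S k) x := by
  have h2d := two_d_ne hd
  have hs0 : 0 ≤ s := by
    by_contra h
    rw [Nat.floor_of_nonpos (by linarith)] at hk
    omega
  have hset : NoReturnUpTo (↑S : Set (Zd d)) s = {ω | ∀ t, 0 < t → t ≤ k + 1 → ω t ∉ S} := by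
    ext ω
    simp only [NoReturnUpTo, Set.mem_ofPred_eq, Finset.mem_coe]
    refine forall_congr' fun t => forall_congr' fun _ => ?_
    rw [← hk, Nat.le_floor_iff hs0]
  have hmeas : MeasurableSet {ω : ℕ → Zd d | ∀ t, 0 < t → t ≤ k + 1 → ω t ∉ S} := by
    simp only [Set.ofPred_forall]
    refine MeasurableSet.iInter fun t => MeasurableSet.iInter fun _ => MeasurableSet.iInter fun _ => ?_
    have : {ω : ℕ → Zd d | ω t ∉ S} = (fun ω : ℕ → Zd d => ω t) ⁻¹' ((↑S : Set (Zd d))ᶜ) := by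
      ext; simp
    rw [this]
    exact measurable_pi_apply t (S.finite_toSet.measurableSet.compl)
  rw [hset]
  have h1 := integral_indicator_one (μ := P) hmeas
  rw [Measure.real] at h1
  rw [← h1, integral_eq_ev hd hP (k + 1)]
  · simp only [ev, Pop_apply]
    have : ∀ s : Fin d × Bool, ev k (0 + 1) (Function.update (fun _ => x) (0 + 1) (x + stp s))
        ({ω : ℕ → Zd d | ∀ t, 0 < t → t ≤ k + 1 → ω t ∉ S}.indicator 1) =
          1 - hit S k (x + stp s) := by
      intro s
      have h1 := ev_avoid hd S k (0 + 1) (Function.update (fun _ => x) (0 + 1) (x + stp s))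
      rw [Function.update_self] at h1
      rw [← h1]
      refine ev_congr _ _ _ _ _ fun ω hω => ?_
      rw [Set.indicator_apply]
      simp only [Set.mem_ofPred_eq, Pi.one_apply]
      congr 1
      apply propext
      constructor
      · intro h t h1 h2; exact h t (by omega) (by omega)
      · intro h t h1 h2; exact h t (by omega) (by omega)
    simp only [this, Finset.sum_sub_distrib, Finset.sum_const, Finset.card_univ,
        Fintype.card_prod, Fintype.card_fin, Fintype.card_bool, nsmul_eq_mul]
    push_cast
    field_simp
  · intro ω ω' h
    simp only [Set.indicator_apply, Set.mem_ofPred_eq]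
    congr 1
    apply propext
    constructor
    · intro h' t h1 h2; rw [← h t h2]; exact h' t h1 h2
    · intro h' t h1 h2; rw [h t h2]; exact h' t h1 h2

def capk {d : ℕ} (S : Finset (Zd d)) (k : ℕ) : ℝ := ∑ x ∈ S, (1 - Pop d (hit S k) x)

theorem capk_anti {d : ℕ} (S : Finset (Zd d)) (k : ℕ) : capk S (k + 1) ≤ capk S k := by
  unfold capk
  refine Finset.sum_le_sum fun x _ => ?_
  have := Pop_mono (hit_mono_time S k) x
  linarith

theorem tsum_hit_succ {d : ℕ} (hd : 0 < d) (S : Finset (Zd d)) (k : ℕ) :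
    ∑' z, hit S (k + 1) z = ∑' z, hit S k z + capk S k := by
  have e : ∀ z, hit S (k + 1) z = Pop d (hit S k) z +
      (if z ∈ S then 1 - Pop d (hit S k) z else 0) := by
    intro z
    simp only [hit]
    split_ifs <;> ring
  have hfs : (Function.support fun z => if z ∈ S then 1 - Pop d (hit S k) z else 0).Finite := by
    refine S.finite_toSet.subset ?_
    intro x hx
    by_contra h
    exact hx (if_neg h)
  rw [tsum_congr e, (fs_summable (Pop_fs (hit_fs S k))).tsum_add (fs_summable hfs)]
  have h1 := tsum_PopPow hd 1 (hit_fs S k)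
  rw [pow_one] at h1
  rw [h1]
  congr 1
  rw [tsum_eq_sum (s := S)]
  · unfold capk
    exact Finset.sum_congr rfl fun x hx => if_pos hx
  · intro b hb; exact if_neg hb

theorem capk_le_tsum {d : ℕ} (hd : 0 < d) (S : Finset (Zd d)) (k : ℕ) :
    ((k : ℝ) + 1) * capk S k ≤ ∑' z, hit S (k + 1) z := by
  induction k with
  | zero =>
    rw [tsum_hit_succ hd]
    have : 0 ≤ ∑' z, hit S 0 z := tsum_nonneg (hit_nonneg S 0)
    push_cast
    linarith
  | succ k ih =>
    rw [tsum_hit_succ hd]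
    have := capk_anti S k
    push_cast
    nlinarith

theorem capTrunc_le {d : ℕ} (hd : 0 < d) {Pw : Zd d → Measure (ℕ → Zd d)}
    (hPw : IsSRWFamily d Pw) (S : Finset (Zd d)) (s : ℝ) (k : ℕ)
    (hk : ⌊s / (Real.log s) ^ (10 : ℕ)⌋₊ = k + 1) :
    capTrunc Pw S s ≤ 1 / ((k : ℝ) + 1) * ∑' z, hit S (k + 1) z := by
  have h : capTrunc Pw S s = capk S k := by
    unfold capTrunc capk
    exact Finset.sum_congr rfl fun x _ => noReturn_eq hd (hPw x) S _ k hk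
  rw [h]
  have := capk_le_tsum hd S k
  rw [one_div, ← div_eq_inv_mul, le_div_iff₀ (by positivity)]
  linarith

/-- Green potential up to time `n`. -/
def Gr {d : ℕ} (n : ℕ) (f : Zd d → ℝ) (z : Zd d) : ℝ := ∑ i ∈ Finset.range n, (Pop d ^ i) f z

theorem Gr_mono_time {d : ℕ} {f : Zd d → ℝ} (hf : ∀ x, 0 ≤ f x) {m n : ℕ} (h : m ≤ n) (z : Zd d) :
    Gr m f z ≤ Gr n f z := by
  unfold Gr
  refine Finset.sum_le_sum_of_subset_of_nonneg (Finset.range_mono h) fun i _ _ => ?_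
  exact PopPow_nonneg i hf z

theorem Pop_Gr {d : ℕ} (f : Zd d → ℝ) (n : ℕ) (z : Zd d) :
    Pop d (Gr n f) z + f z = Gr (n + 1) f z := by
  have : Gr n f = ∑ i ∈ Finset.range n, (Pop d ^ i) f := by
    funext z; simp [Gr]
  rw [this, map_sum]
  unfold Gr
  rw [Finset.sum_range_succ']
  simp only [pow_zero, Module.End.one_apply, Finset.sum_apply, pow_succ_apply]

theorem hit_le_Gr {d : ℕ} {f : Zd d → ℝ} (hf : ∀ x, 0 ≤ f x) (S : Finset (Zd d))
    (c : ℝ) (M : ℕ) (hS : ∀ z ∈ S, c ≤ Gr M f z) (k : ℕ) :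
    ∀ z, c * hit S k z ≤ Gr (k + M) f z := by
  have h0 : ∀ n z, 0 ≤ Gr n f z := fun n z => Finset.sum_nonneg fun i _ => PopPow_nonneg i hf z
  induction k with
  | zero =>
    intro z
    by_cases h : z ∈ S
    · rw [hit_mem h]; simpa using hS z h
    · simpa [hit, h] using h0 M z
  | succ k ih =>
    intro z
    by_cases h : z ∈ S
    · rw [hit_mem h, mul_one]
      exact (hS z h).trans (Gr_mono_time hf (by omega) z)
    · simp only [hit, h, if_false]
      have e : c * Pop d (hit S k) z = Pop d (c • hit S k) z := by rw [map_smul]; rfl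
      rw [e]
      have h1 := Pop_mono (f := c • hit S k) (g := Gr (k + M) f) ih z
      have h2 := Pop_Gr f (k + M) z
      rw [show k + 1 + M = k + M + 1 by ring, ← h2]
      have := hf z
      linarith

/-! ### Gaussian-type tail bound: the far part -/

def cw {d : ℕ} (lam : ℝ) (x : Zd d) : ℝ := ∑ c, 2 * Real.cosh (lam * x c)

theorem cw_nonneg {d : ℕ} (lam : ℝ) (x : Zd d) : 0 ≤ cw lam x :=
  Finset.sum_nonneg fun c _ => by have := Real.cosh_pos (lam * x c); positivity

theorem Pop_cosh {d : ℕ} (hd : 0 < d) (lam : ℝ) (c : Fin d) (x : Zd d) :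
    Pop d (fun x => Real.cosh (lam * x c)) x =
      (1 - 1 / d + Real.cosh lam / d) * Real.cosh (lam * x c) := by
  have hd' : (d : ℝ) ≠ 0 := by positivity
  rw [Pop_apply, Fintype.sum_prod_type, ← Finset.add_sum_erase _ _ (Finset.mem_univ c)]
  have h1 : ∑ b : Bool, Real.cosh (lam * ((x + stp (c, b)) c : ℤ)) =
      2 * Real.cosh lam * Real.cosh (lam * x c) := by
    rw [Fintype.sum_bool]
    simp only [stp, Pi.add_apply, Pi.single_eq_same, if_true, Bool.false_eq_true, if_false]
    push_cast
    rw [mul_add, mul_add, Real.cosh_add, Real.cosh_add, mul_one, mul_neg, mul_one, Real.cosh_neg,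
      Real.sinh_neg]
    ring
  have h2 : ∀ i ∈ Finset.univ.erase c, ∑ b : Bool, Real.cosh (lam * ((x + stp (i, b)) c : ℤ)) =
      2 * Real.cosh (lam * x c) := by
    intro i hi
    have hic : c ≠ i := (Finset.ne_of_mem_erase hi).symm
    rw [Fintype.sum_bool]
    simp only [stp, Pi.add_apply, Pi.single_eq_of_ne hic, add_zero]
    ring
  rw [h1, Finset.sum_congr rfl h2, Finset.sum_const, Finset.card_erase_of_mem (Finset.mem_univ c),
    Finset.card_univ, Fintype.card_fin, nsmul_eq_mul, Nat.cast_sub (by omega)]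
  push_cast
  field_simp
  ring

theorem PopPow_cw {d : ℕ} (hd : 0 < d) (lam : ℝ) (i : ℕ) : ∀ x : Zd d,
    (Pop d ^ i) (cw lam) x = (1 - 1 / d + Real.cosh lam / d) ^ i * cw lam x := by
  have h1 : Pop d (cw lam) = (1 - 1 / d + Real.cosh lam / d) • (cw lam : Zd d → ℝ) := by
    have e : (cw lam : Zd d → ℝ) = ∑ c, (2 : ℝ) • fun x : Zd d => Real.cosh (lam * x c) := by
      funext x; simp [cw]
    rw [e, map_sum, Finset.smul_sum]
    refine Finset.sum_congr rfl fun c _ => ?_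
    rw [map_smul]
    funext x
    simp only [Pi.smul_apply, smul_eq_mul]
    rw [Pop_cosh hd]
    ring
  induction i with
  | zero => intro x; simp
  | succ i ih =>
    intro x
    have h2 : (Pop d ^ i) (cw lam) = ((1 - 1 / d + Real.cosh lam / d) ^ i) •
        (cw lam : Zd d → ℝ) := by
      funext y; rw [ih y]; rfl
    rw [pow_succ_apply, h2, map_smul, h1]
    simp only [Pi.smul_apply, smul_eq_mul]
    ring

theorem tail_sum {d : ℕ} (hd : 0 < d) (lam L : ℝ) (hl : 0 ≤ lam) (i : ℕ) (F : Finset (Zd d))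
    (hF : ∀ x ∈ F, ∃ c, L ≤ |(x c : ℝ)|) :
    ∑ x ∈ F, (Pop d ^ i) dl x ≤ 2 * d * Real.exp (-lam * L + i * (lam ^ 2 / 2)) := by
  have hd' : (0 : ℝ) < d := by exact_mod_cast hd
  have hp0 : ∀ x : Zd d, 0 ≤ (Pop d ^ i) dl x := PopPow_nonneg i dl_nonneg
  have h1 : ∀ x ∈ F, (Pop d ^ i) dl x ≤ Real.exp (-lam * L) * (cw lam x * (Pop d ^ i) dl x) := by
    intro x hx
    obtain ⟨c, hc⟩ := hF x hx
    have h2 : Real.exp (lam * L) ≤ cw lam x := by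
      have h3 : 2 * Real.cosh (lam * x c) ≤ cw lam x :=
        Finset.single_le_sum (f := fun c => 2 * Real.cosh (lam * x c))
          (fun c _ => by have := Real.cosh_pos (lam * x c); positivity) (Finset.mem_univ c)
      have h4 : Real.exp (lam * |(x c : ℝ)|) ≤ 2 * Real.cosh (lam * x c) := by
        rw [← Real.cosh_abs, abs_mul, abs_of_nonneg hl, Real.cosh_eq]
        have := Real.exp_pos (-(lam * |(x c : ℝ)|))
        linarith
      have h5 : Real.exp (lam * L) ≤ Real.exp (lam * |(x c : ℝ)|) := by
        apply Real.exp_le_exp.2; gcongr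
      linarith
    have h3 : 1 ≤ Real.exp (-lam * L) * cw lam x := by
      calc (1 : ℝ) = Real.exp (-lam * L) * Real.exp (lam * L) := by
            rw [← Real.exp_add]; simp
        _ ≤ _ := by gcongr
    rw [← mul_assoc]
    exact le_mul_of_one_le_left (hp0 x) h3
  refine (Finset.sum_le_sum h1).trans ?_
  rw [← Finset.mul_sum]
  have h2 : ∑ x ∈ F, cw lam x * (Pop d ^ i) dl x ≤ ∑' x : Zd d, cw lam x * (Pop d ^ i) dl x := by
    refine Summable.sum_le_tsum F (fun x _ => mul_nonneg (cw_nonneg _ _) (hp0 x)) ?_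
    refine fs_summable ((PopPow_fs dl_fs i).subset ?_)
    intro x hx
    exact right_ne_zero_of_mul hx
  rw [tsum_PopPow_mul i dl_fs] at h2
  have h3 : ∑' x : Zd d, (Pop d ^ i) (cw lam) x * dl x =
      (1 - 1 / d + Real.cosh lam / d) ^ i * (2 * d) := by
    rw [tsum_eq_single 0]
    · rw [PopPow_cw hd, mul_assoc]
      congr 1
      simp [cw, dl, mul_comm]
    · intro b hb; simp [dl, hb]
  rw [h3] at h2
  have h4 : (1 - 1 / d + Real.cosh lam / d) ≤ Real.exp (lam ^ 2 / 2) := by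
    have h5 := Real.cosh_le_exp_half_sq lam
    have h6 := Real.one_le_cosh lam
    have h7 : (1 - 1 / d + Real.cosh lam / d) = 1 + (Real.cosh lam - 1) / d := by ring
    have h8 : (Real.cosh lam - 1) / d ≤ Real.cosh lam - 1 := by
      apply div_le_self (by linarith)
      exact_mod_cast hd
    linarith
  have h5 : 0 ≤ (1 - 1 / (d : ℝ) + Real.cosh lam / d) := by
    have h6 := Real.one_le_cosh lam
    have h7 : (1 - 1 / d + Real.cosh lam / d) = 1 + (Real.cosh lam - 1) / d := by ring
    rw [h7]
    have : 0 ≤ (Real.cosh lam - 1) / d := div_nonneg (by linarith) hd'.le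
    linarith
  calc Real.exp (-lam * L) * ∑ x ∈ F, cw lam x * (Pop d ^ i) dl x
      ≤ Real.exp (-lam * L) * (Real.exp (lam ^ 2 / 2) ^ i * (2 * d)) := by
        gcongr
        refine h2.trans ?_
        gcongr
    _ = _ := by
        rw [Real.exp_add, ← Real.exp_nat_mul]
        ring

theorem PopPow_sum {d : ℕ} {ι : Type*} (J : Finset ι) (i : ℕ) (f : ι → Zd d → ℝ) (z : Zd d) :
    (Pop d ^ i) (fun x => ∑ j ∈ J, f j x) z = ∑ j ∈ J, (Pop d ^ i) (f j) z := by
  have : (fun x => ∑ j ∈ J, f j x) = ∑ j ∈ J, f j := by funext x; simp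
  rw [this, map_sum, Finset.sum_apply]

/-- Union bound for the hitting probability. -/
theorem hit_le_sum {d : ℕ} {ι : Type*} (J : Finset ι) (v : ι → Zd d) (S : Finset (Zd d))
    (hS : ∀ x ∈ S, ∃ j ∈ J, v j = x) (k : ℕ) (z : Zd d) :
    hit S k z ≤ ∑ i ∈ Finset.range (k + 1), ∑ j ∈ J, (Pop d ^ i) dl (z - v j) := by
  have h := hit_le_Gr (f := fun x => ∑ j ∈ J, dl (x - v j))
    (fun x => Finset.sum_nonneg fun j _ => dl_nonneg _) S 1 1 ?_ k z
  · rw [one_mul] at h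
    refine h.trans (le_of_eq ?_)
    unfold Gr
    refine Finset.sum_congr rfl fun i _ => ?_
    rw [PopPow_sum]
    exact Finset.sum_congr rfl fun j _ => PopPow_translate i dl (v j) z
  · intro x hx
    obtain ⟨j, hj, rfl⟩ := hS x hx
    simp only [Gr, Finset.range_one, Finset.sum_singleton, pow_zero, Module.End.one_apply]
    have := Finset.single_le_sum (f := fun i => (dl (v j - v i) : ℝ))
      (fun i _ => dl_nonneg _) hj
    simpa [dl] using this

theorem far_sum {d : ℕ} (hd : 0 < d) (A : Finset (Zd d)) (lam L : ℝ) (hl : 0 ≤ lam) (k : ℕ)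
    (F : Finset (Zd d)) (hF : ∀ z ∈ F, z ∉ nbhd (A : Set (Zd d)) L) :
    ∑ z ∈ F, hit A k z ≤
      A.card * (k + 1) * (2 * d * Real.exp (-lam * L + k * (lam ^ 2 / 2))) := by
  have h1 : ∑ z ∈ F, hit A k z ≤
      ∑ z ∈ F, ∑ i ∈ Finset.range (k + 1), ∑ a ∈ A, (Pop d ^ i) dl (z - a) :=
    Finset.sum_le_sum fun z _ => hit_le_sum A (fun a => a) A (fun x hx => ⟨x, hx, rfl⟩) k z
  refine h1.trans ?_
  rw [Finset.sum_comm]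
  have h2 : ∀ i ∈ Finset.range (k + 1), ∑ z ∈ F, ∑ a ∈ A, (Pop d ^ i) dl (z - a) ≤
      A.card * (2 * d * Real.exp (-lam * L + k * (lam ^ 2 / 2))) := by
    intro i hi
    have hik : (i : ℝ) ≤ k := by
      have := Finset.mem_range.1 hi
      exact_mod_cast (by omega : i ≤ k)
    rw [Finset.sum_comm, ← nsmul_eq_mul]
    refine Finset.sum_le_card_nsmul _ _ _ fun a ha => ?_
    have h3 : ∑ z ∈ F, (Pop d ^ i) dl (z - a) =
        ∑ x ∈ F.map ⟨fun z => z - a, sub_left_injective⟩, (Pop d ^ i) dl x := by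
      rw [Finset.sum_map]; rfl
    rw [h3]
    refine (tail_sum hd lam L hl i _ ?_).trans ?_
    · intro x hx
      rw [Finset.mem_map] at hx
      obtain ⟨z, hz, rfl⟩ := hx
      by_contra hcon
      push Not at hcon
      apply hF z hz
      refine ⟨a, ha, fun c => ?_⟩
      exact (hcon c).le
    · gcongr
  refine (Finset.sum_le_sum h2).trans (le_of_eq ?_)
  rw [Finset.sum_const, Finset.card_range, nsmul_eq_mul]
  push_cast
  ring

/-! ### The potential `ψ` in dimension four -/

def nsq {d : ℕ} (x : Zd d) : ℝ := ∑ i, (x i : ℝ) ^ 2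

theorem nsq_nonneg {d : ℕ} (x : Zd d) : 0 ≤ nsq x := Finset.sum_nonneg fun i _ => sq_nonneg _

theorem sq_le_nsq {d : ℕ} (x : Zd d) (i : Fin d) : (x i : ℝ) ^ 2 ≤ nsq x :=
  Finset.single_le_sum (f := fun i => (x i : ℝ) ^ 2) (fun i _ => sq_nonneg _) (Finset.mem_univ i)

theorem nsq_step {d : ℕ} (x : Zd d) (i : Fin d) (b : Bool) :
    nsq (x + stp (i, b)) = nsq x + 2 * (if b then 1 else -1) * x i + 1 := by
  unfold nsq
  rw [← Finset.add_sum_erase _ _ (Finset.mem_univ i),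
    ← Finset.add_sum_erase (f := fun i => (x i : ℝ) ^ 2) _ (Finset.mem_univ i)]
  have : ∑ j ∈ Finset.univ.erase i, (((x + stp (i, b)) j : ℤ) : ℝ) ^ 2 =
      ∑ j ∈ Finset.univ.erase i, (x j : ℝ) ^ 2 := by
    refine Finset.sum_congr rfl fun j hj => ?_
    simp [stp, Pi.single_eq_of_ne (Finset.ne_of_mem_erase hj)]
  rw [this]
  simp only [stp, Pi.add_apply, Pi.single_eq_same]
  cases b
  · simp only [Bool.false_eq_true, if_false]; push_cast; ring
  · simp only [if_true]; push_cast; ring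

def psi (x : Zd 4) : ℝ := 1 / max 1 (nsq x - 3)

def boxF (d q : ℕ) : Finset (Zd d) := Fintype.piFinset fun _ => Finset.Icc (-(q : ℤ)) q

theorem card_boxF (d q : ℕ) : (boxF d q).card = (2 * q + 1) ^ d := by
  unfold boxF
  rw [Fintype.card_piFinset]
  simp only [Int.card_Icc, Finset.prod_const, Finset.card_univ, Fintype.card_fin]
  congr 1
  omega

theorem not_boxF {d q : ℕ} {x : Zd d} (h : x ∉ boxF d q) : ((q : ℝ) + 1) ^ 2 ≤ nsq x := by
  simp only [boxF, Fintype.mem_piFinset, Finset.mem_Icc, not_forall] at h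
  obtain ⟨i, hi⟩ := h
  refine le_trans ?_ (sq_le_nsq x i)
  have h1 : (q : ℤ) + 1 ≤ |x i| := by
    rcases abs_cases (x i) with h | h <;> omega
  have h2 : (q : ℝ) + 1 ≤ |(x i : ℝ)| := by exact_mod_cast h1
  rw [← sq_abs (x i : ℝ)]
  gcongr

def ib (q : ℕ) (x : Zd 4) : ℝ := if x ∈ boxF 4 q then 1 else 0

theorem ib_nonneg (q : ℕ) (x : Zd 4) : 0 ≤ ib q x := by unfold ib; split_ifs <;> norm_num

theorem ib_fs (q : ℕ) : (ib q).support.Finite := indic_fs _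

theorem tsum_ib (q : ℕ) : ∑' x, ib q x = (2 * (q : ℝ) + 1) ^ 4 := by
  have := tsum_indic (boxF 4 q)
  rw [card_boxF] at this
  unfold ib
  rw [this]
  push_cast
  ring

theorem psi_nonneg (x : Zd 4) : 0 ≤ psi x := by unfold psi; positivity

theorem psi_le_one (x : Zd 4) : psi x ≤ 1 := by
  unfold psi
  rw [div_le_one (by positivity)]
  exact le_max_left _ _

theorem psi_ge (x : Zd 4) : 1 / (1 + nsq x) ≤ psi x := by
  unfold psi
  have := nsq_nonneg x
  apply one_div_le_one_div_of_le (by positivity)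
  apply max_le <;> linarith

theorem psi_super (x : Zd 4) : psi x - ib 4 x ≤ Pop 4 psi x := by
  by_cases hx : x ∈ boxF 4 4
  · have h1 := Pop_nonneg psi_nonneg x
    have h2 := psi_le_one x
    simp only [ib, hx, if_true]
    linarith
  · have hr : 25 ≤ nsq x := by
      have := not_boxF hx
      push_cast at this
      linarith
    simp only [ib, hx, if_false, sub_zero]
    set u := nsq x - 2 with hu
    have hu' : 23 ≤ u := by linarith
    have h1 : psi x = 1 / (u - 1) := by
      unfold psi
      rw [max_eq_right (by linarith)]
      congr 1; linarith
    have h2 : ∀ i : Fin 4, 2 / u + 8 * (x i : ℝ) ^ 2 / u ^ 3 ≤ ∑ b : Bool, psi (x + stp (i, b)) := by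
      intro i
      have hxi := sq_le_nsq x i
      have hb : |2 * (x i : ℝ)| ≤ u - 1 := by
        apply abs_le_of_sq_le_sq _ (by linarith)
        nlinarith
      obtain ⟨hb1, hb2⟩ := abs_le.1 hb
      rw [Fintype.sum_bool]
      unfold psi
      rw [nsq_step, nsq_step]
      simp only [if_true, Bool.false_eq_true, if_false]
      rw [max_eq_right (by linarith), max_eq_right (by linarith)]
      have e1 : nsq x + 2 * 1 * (x i : ℝ) + 1 - 3 = u + 2 * x i := by rw [hu]; ring
      have e2 : nsq x + 2 * -1 * (x i : ℝ) + 1 - 3 = u - 2 * x i := by rw [hu]; ring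
      rw [e1, e2]
      have p1 : 0 < u + 2 * x i := by linarith
      have p2 : 0 < u - 2 * x i := by linarith
      have p3 : 0 < u := by linarith
      rw [div_add_div _ _ p3.ne' (by positivity), div_add_div _ _ p1.ne' p2.ne',
        div_le_div_iff₀ (by positivity) (by positivity)]
      have : 0 ≤ u * (x i : ℝ) ^ 4 := by positivity
      nlinarith
    rw [Pop_apply, Fintype.sum_prod_type, h1]
    have h3 : ∑ i : Fin 4, (2 / u + 8 * (x i : ℝ) ^ 2 / u ^ 3) = 8 / u + 8 * nsq x / u ^ 3 := by
      rw [Finset.sum_add_distrib, ← Finset.sum_div, ← Finset.sum_div, ← Finset.mul_sum]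
      congr 1
      simp
      ring
    have h4 := Finset.sum_le_sum fun i (_ : i ∈ Finset.univ) => h2 i
    rw [h3] at h4
    have h5 : 1 / (u - 1) ≤ 1 / u + nsq x / u ^ 3 := by
      have p3 : 0 < u := by linarith
      have p4 : 0 < u - 1 := by linarith
      have e : nsq x = u + 2 := by rw [hu]; ring
      rw [e, div_add_div _ _ p3.ne' (by positivity), div_le_div_iff₀ p4 (by positivity)]
      nlinarith [pow_pos p3 2]
    have e6 : 8 / u + 8 * nsq x / u ^ 3 = 8 * (1 / u + nsq x / u ^ 3) := by ring
    push_cast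
    linarith

theorem Gr_psi (M : ℕ) (z : Zd 4) : psi z - (Pop 4 ^ M) psi z ≤ Gr M (ib 4) z := by
  induction M with
  | zero => simp [Gr]
  | succ M ih =>
    have h1 : (Pop 4 ^ M) (psi - ib 4) z ≤ (Pop 4 ^ M) (Pop 4 psi) z :=
      PopPow_mono M psi_super z
    rw [map_sub, Pi.sub_apply] at h1
    have h2 : (Pop 4 ^ M) (Pop 4 psi) = (Pop 4 ^ (M + 1)) psi := by
      rw [pow_succ, Module.End.mul_apply]
    rw [h2] at h1
    have h3 : Gr (M + 1) (ib 4) z = Gr M (ib 4) z + (Pop 4 ^ M) (ib 4) z := by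
      unfold Gr; rw [Finset.sum_range_succ]
    linarith

theorem kc4 (j : ℕ) (hj : 0 < j) : kc 4 * (j : ℝ) ^ (-(((4 : ℕ) : ℝ) / 2)) = kc 4 / (j : ℝ) ^ 2 := by
  have hj' : (0 : ℝ) < j := by exact_mod_cast hj
  rw [Real.rpow_neg hj'.le, div_eq_mul_inv]
  congr 2
  rw [← Real.rpow_natCast]
  norm_num

theorem visit4 (j : ℕ) (hj : 0 < j) {g : Zd 4 → ℝ} (hg : g.support.Finite)
    (hg0 : ∀ x, 0 ≤ g x) (y : Zd 4) :
    (Pop 4 ^ j) g y ≤ kc 4 / (j : ℝ) ^ 2 * ∑' x, g x := by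
  rw [← kc4 j hj]
  exact visit_le (by norm_num) j hj hg hg0 y

theorem PopPow_psi_le (q : ℕ) (hq : 0 < q) (z : Zd 4) :
    (Pop 4 ^ (q ^ 4)) psi z ≤ (81 * kc 4 + 2) / (q : ℝ) ^ 2 := by
  have hq' : (1 : ℝ) ≤ q := by exact_mod_cast hq
  have h1 : ∀ x, psi x ≤ (ib q + (fun _ => 2 / (q : ℝ) ^ 2 : Zd 4 → ℝ)) x := by
    intro x
    simp only [Pi.add_apply]
    by_cases hx : x ∈ boxF 4 q
    · have := psi_le_one x
      have : 0 ≤ 2 / (q : ℝ) ^ 2 := by positivity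
      simp only [ib, hx, if_true]
      linarith
    · simp only [ib, hx, if_false, zero_add]
      have := not_boxF hx
      unfold psi
      rw [div_le_div_iff₀ (by positivity) (by positivity)]
      have := le_max_right 1 (nsq x - 3)
      nlinarith
  refine (PopPow_mono _ h1 z).trans ?_
  rw [map_add, PopPow_const (by norm_num), Pi.add_apply]
  have h2 := visit4 (q ^ 4) (by positivity) (ib_fs q) (ib_nonneg q) z
  rw [tsum_ib] at h2
  have h3 : kc 4 / ((q ^ 4 : ℕ) : ℝ) ^ 2 * (2 * (q : ℝ) + 1) ^ 4 ≤ 81 * kc 4 / (q : ℝ) ^ 2 := by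
    have hk := kc_pos (d := 4) (by norm_num)
    rw [div_mul_eq_mul_div, div_le_div_iff₀ (by positivity) (by positivity)]
    push_cast
    have h4 : (2 * (q : ℝ) + 1) ^ 4 ≤ (3 * q) ^ 4 := by gcongr; linarith
    have h5 : (q : ℝ) ^ 6 ≤ q ^ 8 := pow_le_pow_right₀ hq' (by norm_num)
    calc kc 4 * (2 * (q : ℝ) + 1) ^ 4 * q ^ 2 ≤ kc 4 * (3 * q) ^ 4 * q ^ 2 := by gcongr
      _ = 81 * kc 4 * q ^ 6 := by ring
      _ ≤ 81 * kc 4 * q ^ 8 := by gcongr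
      _ = _ := by ring
  rw [add_div]
  linarith

/-! ### Second moment estimate for the local potential along the walk -/

def Dd {d : ℕ} (o : Zd d) (ω : ℕ → Zd d) (t : ℕ) : ℝ :=
  nsq (ω (t + 1) - o) - nsq (ω t - o) - 1

theorem ev_var (o : Zd 4) (a : ℕ → ℝ) (k : ℕ) : ∀ (T : ℕ) (w : ℕ → Zd 4) (b : ℝ),
    ev k T w (fun ω => (b + ∑ i ∈ Finset.range k, a (T + i) * Dd o ω (T + i)) ^ 2) =
      b ^ 2 + ∑ i ∈ Finset.range k, a (T + i) ^ 2 * (nsq (w T - o) + i) := by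
  induction k with
  | zero => intro T w b; simp [ev]
  | succ k ih =>
    intro T w b
    simp only [ev]
    have h1 : ∀ s : Fin 4 × Bool, ev k (T + 1) (Function.update w (T + 1) (w T + stp s))
        (fun ω => (b + ∑ i ∈ Finset.range (k + 1), a (T + i) * Dd o ω (T + i)) ^ 2) =
        (b + a T * (2 * (if s.2 then 1 else -1) * ((w T - o) s.1 : ℤ))) ^ 2 +
        ∑ i ∈ Finset.range k, a (T + 1 + i) ^ 2 *
          (nsq (w T - o) + 2 * (if s.2 then 1 else -1) * ((w T - o) s.1 : ℤ) + 1 + i) := by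
      intro s
      have hs : nsq (w T + stp s - o) =
          nsq (w T - o) + 2 * (if s.2 then 1 else -1) * ((w T - o) s.1 : ℤ) + 1 := by
        have := nsq_step (w T - o) s.1 s.2
        rw [← this]
        congr 1
        rw [show (s.1, s.2) = s from rfl]
        abel
      have h2 := ih (T + 1) (Function.update w (T + 1) (w T + stp s))
        (b + a T * (2 * (if s.2 then 1 else -1) * ((w T - o) s.1 : ℤ)))
      rw [Function.update_self, hs] at h2
      rw [← h2]
      refine ev_congr _ _ _ _ _ fun ω hω => ?_
      rw [cyl_update] at hω
      congr 1
      rw [Finset.sum_range_succ', add_zero]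
      have h3 : Dd o ω T = 2 * (if s.2 then 1 else -1) * ((w T - o) s.1 : ℤ) := by
        unfold Dd
        rw [hω.2, hω.1 T le_rfl, hs]
        ring
      rw [h3]
      have h4 : ∑ i ∈ Finset.range k, a (T + (i + 1)) * Dd o ω (T + (i + 1)) =
          ∑ i ∈ Finset.range k, a (T + 1 + i) * Dd o ω (T + 1 + i) := by
        refine Finset.sum_congr rfl fun i _ => ?_
        rw [show T + (i + 1) = T + 1 + i by ring]
      rw [h4]
      ring
    rw [Finset.sum_congr rfl fun s _ => h1 s, Fintype.sum_prod_type]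
    simp only [Fintype.sum_bool, if_true, Bool.false_eq_true, if_false]
    rw [Finset.sum_range_succ']
    have h5 : ∀ i : Fin 4,
        ((b + a T * (2 * 1 * (((w T - o) i : ℤ) : ℝ))) ^ 2 +
        ∑ l ∈ Finset.range k, a (T + 1 + l) ^ 2 *
          (nsq (w T - o) + 2 * 1 * (((w T - o) i : ℤ) : ℝ) + 1 + l)) +
        ((b + a T * (2 * -1 * (((w T - o) i : ℤ) : ℝ))) ^ 2 +
        ∑ l ∈ Finset.range k, a (T + 1 + l) ^ 2 *
          (nsq (w T - o) + 2 * -1 * (((w T - o) i : ℤ) : ℝ) + 1 + l)) =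
        2 * b ^ 2 + 8 * a T ^ 2 * (((w T - o) i : ℤ) : ℝ) ^ 2 +
          2 * ∑ l ∈ Finset.range k, a (T + 1 + l) ^ 2 * (nsq (w T - o) + 1 + l) := by
      intro i
      have e : ∑ l ∈ Finset.range k, a (T + 1 + l) ^ 2 *
          (nsq (w T - o) + 2 * 1 * (((w T - o) i : ℤ) : ℝ) + 1 + l) +
          ∑ l ∈ Finset.range k, a (T + 1 + l) ^ 2 *
          (nsq (w T - o) + 2 * -1 * (((w T - o) i : ℤ) : ℝ) + 1 + l) =
          2 * ∑ l ∈ Finset.range k, a (T + 1 + l) ^ 2 * (nsq (w T - o) + 1 + l) := by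
        rw [← Finset.sum_add_distrib, Finset.mul_sum]
        refine Finset.sum_congr rfl fun l _ => ?_
        ring
      linear_combination e
    rw [Finset.sum_congr rfl fun i _ => h5 i, Finset.sum_add_distrib, Finset.sum_add_distrib,
      ← Finset.mul_sum Finset.univ (fun i : Fin 4 => (((w T - o) i : ℤ) : ℝ) ^ 2)]
    have h6 : ∑ i : Fin 4, (((w T - o) i : ℤ) : ℝ) ^ 2 = nsq (w T - o) := rfl
    rw [h6]
    have h7 : ∑ i ∈ Finset.range k, a (T + (i + 1)) ^ 2 * (nsq (w T - o) + ((i + 1 : ℕ) : ℝ)) =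
        ∑ l ∈ Finset.range k, a (T + 1 + l) ^ 2 * (nsq (w T - o) + 1 + l) := by
      refine Finset.sum_congr rfl fun i _ => ?_
      rw [show T + (i + 1) = T + 1 + i by ring]
      push_cast
      ring
    rw [h7]
    simp only [Finset.sum_const, Finset.card_univ, Fintype.card_fin, nsmul_eq_mul, add_zero]
    push_cast
    ring

def harm (m : ℕ) : ℝ := ∑ i ∈ Finset.range m, 1 / ((i : ℝ) + 1)

def Wj (m j : ℕ) (ω : ℕ → Zd 4) : ℝ :=
  ∑ i ∈ Finset.range m, nsq (ω (j + i + 1) - ω j) / ((i : ℝ) + 1) ^ 2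

def bad (m j : ℕ) (ω : ℕ → Zd 4) : Prop := 2 * harm m < Wj m j ω

theorem harm_pos {m : ℕ} (hm : 0 < m) : 0 < harm m := by
  unfold harm
  apply Finset.sum_pos
  · intro i _; positivity
  · exact ⟨0, Finset.mem_range.2 hm⟩

theorem nsq_telescope (o : Zd 4) (ω : ℕ → Zd 4) (j : ℕ) (h : ω j = o) (l : ℕ) :
    nsq (ω (j + l) - o) = l + ∑ i ∈ Finset.range l, Dd o ω (j + i) := by
  induction l with
  | zero => simp [h, nsq]
  | succ l ih =>
    rw [Finset.sum_range_succ]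
    unfold Dd at ih ⊢
    rw [← add_assoc]
    push_cast
    linarith

theorem W_sub_H (m j : ℕ) (ω : ℕ → Zd 4) :
    Wj m j ω - harm m = ∑ i ∈ Finset.range m,
      (∑ l ∈ Finset.Ico i m, 1 / ((l : ℝ) + 1) ^ 2) * Dd (ω j) ω (j + i) := by
  unfold Wj harm
  rw [← Finset.sum_sub_distrib]
  have h1 : ∀ l ∈ Finset.range m, nsq (ω (j + l + 1) - ω j) / ((l : ℝ) + 1) ^ 2 -
      1 / ((l : ℝ) + 1) =
      ∑ i ∈ Finset.range (l + 1), 1 / ((l : ℝ) + 1) ^ 2 * Dd (ω j) ω (j + i) := by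
    intro l _
    rw [add_assoc, nsq_telescope (ω j) ω j rfl (l + 1), ← Finset.mul_sum]
    push_cast
    field_simp
    ring
  rw [Finset.sum_congr rfl h1]
  simp only [Finset.sum_mul]
  apply Finset.sum_comm'
  intro l i
  simp only [Finset.mem_range, Finset.mem_Ico]
  omega

theorem coef_le (i m : ℕ) : ∑ l ∈ Finset.Ico i m, 1 / ((l : ℝ) + 1) ^ 2 ≤ 2 / ((i : ℝ) + 1) := by
  have h := sum_inv_sq_le (i + 1) m (by omega)
  have e : ∑ l ∈ Finset.Ico i m, 1 / ((l : ℝ) + 1) ^ 2 =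
      ∑ j ∈ Finset.Icc (i + 1) m, 1 / (j : ℝ) ^ 2 := by
    have h1 : Finset.Icc (i + 1) m = Finset.Ico (i + 1) (m + 1) := by
      ext; simp only [Finset.mem_Icc, Finset.mem_Ico]; omega
    rw [h1, ← Finset.sum_Ico_add' (fun j : ℕ => 1 / (j : ℝ) ^ 2) i m 1]
    push_cast
    rfl
  rw [e]
  push_cast at h
  exact h

theorem ev_bad (m j : ℕ) (hm : 0 < m) (w : ℕ → Zd 4) :
    ev m j w (fun ω => if bad m j ω then (1 : ℝ) else 0) ≤ 4 / harm m := by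
  have hH := harm_pos hm
  have h1 : ev m j w (fun ω => if bad m j ω then (1 : ℝ) else 0) ≤
      ev m j w (fun ω => 1 / harm m ^ 2 * (0 + ∑ i ∈ Finset.range m,
        (fun t => ∑ l ∈ Finset.Ico (t - j) m, 1 / ((l : ℝ) + 1) ^ 2) (j + i) *
          Dd (w j) ω (j + i)) ^ 2) := by
    refine ev_mono _ _ _ _ _ fun ω hω => ?_
    have h2 : (0 + ∑ i ∈ Finset.range m,
        (fun t => ∑ l ∈ Finset.Ico (t - j) m, 1 / ((l : ℝ) + 1) ^ 2) (j + i) *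
          Dd (w j) ω (j + i)) = Wj m j ω - harm m := by
      rw [W_sub_H, zero_add, hω j le_rfl]
      refine Finset.sum_congr rfl fun i _ => ?_
      simp only [Nat.add_sub_cancel_left]
    rw [h2]
    split_ifs with hb
    · unfold bad at hb
      rw [one_div, ← div_eq_inv_mul, le_div_iff₀ (by positivity)]
      nlinarith
    · positivity
  refine h1.trans ?_
  rw [ev_mul, ev_var (w j) (fun t => ∑ l ∈ Finset.Ico (t - j) m, 1 / ((l : ℝ) + 1) ^ 2) m j w 0]
  simp only [sub_self, Nat.add_sub_cancel_left]
  have h3 : ∑ i ∈ Finset.range m, (∑ l ∈ Finset.Ico i m, 1 / ((l : ℝ) + 1) ^ 2) ^ 2 *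
      (nsq (0 : Zd 4) + i) ≤ ∑ i ∈ Finset.range m, 4 * (1 / ((i : ℝ) + 1)) := by
    refine Finset.sum_le_sum fun i _ => ?_
    have h4 := coef_le i m
    have h5 : 0 ≤ ∑ l ∈ Finset.Ico i m, 1 / ((l : ℝ) + 1) ^ 2 :=
      Finset.sum_nonneg fun l _ => by positivity
    have h6 : nsq (0 : Zd 4) = 0 := by simp [nsq]
    rw [h6, zero_add]
    calc (∑ l ∈ Finset.Ico i m, 1 / ((l : ℝ) + 1) ^ 2) ^ 2 * i
        ≤ (2 / ((i : ℝ) + 1)) ^ 2 * (i + 1) := by gcongr; linarith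
      _ = _ := by field_simp; ring
  rw [← Finset.mul_sum] at h3
  have h4 : 1 / harm m ^ 2 * (4 * harm m) = 4 / harm m := by field_simp
  rw [← h4]
  have : (0 : ℝ) ^ 2 = 0 := by norm_num
  rw [this, zero_add]
  gcongr
  exact h3

theorem good_sum (m j : ℕ) (ω : ℕ → Zd 4) (h : ¬ bad m j ω) :
    harm m / 3 ≤ ∑ i ∈ Finset.range m, psi (ω j - ω (j + i + 1)) := by
  unfold bad at h
  push Not at h
  have h1 : ∀ i ∈ Finset.range m, 2 / 3 * (1 / ((i : ℝ) + 1)) - 1 / 9 * (1 / ((i : ℝ) + 1)) -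
      1 / 9 * (nsq (ω (j + i + 1) - ω j) / ((i : ℝ) + 1) ^ 2) ≤ psi (ω j - ω (j + i + 1)) := by
    intro i _
    refine le_trans ?_ (psi_ge _)
    have e : nsq (ω j - ω (j + i + 1)) = nsq (ω (j + i + 1) - ω j) := by
      unfold nsq
      refine Finset.sum_congr rfl fun c _ => ?_
      simp only [Pi.sub_apply]
      push_cast
      ring
    rw [e]
    set r := nsq (ω (j + i + 1) - ω j) with hr
    have hr0 : 0 ≤ r := nsq_nonneg _
    have hi : (0 : ℝ) < (i : ℝ) + 1 := by positivity
    set t := 1 / (3 * ((i : ℝ) + 1)) with ht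
    have h2 : 2 * t - t ^ 2 * (1 + r) ≤ 1 / (1 + r) := by
      rw [le_div_iff₀ (by positivity)]
      nlinarith [sq_nonneg (t * (1 + r) - 1)]
    have h3 : 2 * t = 2 / 3 * (1 / ((i : ℝ) + 1)) := by rw [ht]; field_simp
    have h4 : t ^ 2 * (1 + r) = 1 / 9 * (1 / ((i : ℝ) + 1) ^ 2) +
        1 / 9 * (r / ((i : ℝ) + 1) ^ 2) := by rw [ht]; field_simp; ring
    have h5 : 1 / ((i : ℝ) + 1) ^ 2 ≤ 1 / ((i : ℝ) + 1) := by
      apply one_div_le_one_div_of_le hi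
      nlinarith [Nat.cast_nonneg (α := ℝ) i]
    linarith
  have h2 := Finset.sum_le_sum h1
  simp only [Finset.sum_sub_distrib, ← Finset.mul_sum] at h2
  refine le_trans ?_ h2
  unfold harm Wj at *
  linarith

/-! ### The near part in dimension four -/

def C1 : ℝ := 81 * kc 4 + 2

theorem C1_pos : 0 < C1 := by
  have := kc_pos (d := 4) (by norm_num)
  unfold C1; positivity

theorem Gr_translate_sum {d : ℕ} {ι : Type*} (J : Finset ι) (v : ι → Zd d) (f : Zd d → ℝ) (n : ℕ)
    (z : Zd d) : Gr n (fun x => ∑ j ∈ J, f (x - v j)) z = ∑ j ∈ J, Gr n f (z - v j) := by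
  unfold Gr
  rw [Finset.sum_comm]
  refine Finset.sum_congr rfl fun i _ => ?_
  rw [PopPow_sum]
  exact Finset.sum_congr rfl fun j _ => PopPow_translate i f (v j) z

theorem good_Gr (q T N j : ℕ) (hq : 0 < q) (ω : ℕ → Zd 4) (hj : j ∈ Finset.Icc T N)
    (h : ¬ bad (q ^ 2) j ω) (hH : 6 * C1 ≤ harm (q ^ 2)) :
    harm (q ^ 2) / 6 ≤
      Gr (q ^ 4) (fun x => ∑ l ∈ Finset.Icc T (N + q ^ 2), ib 4 (x - ω l)) (ω j) := by
  rw [Gr_translate_sum]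
  have hnn : ∀ x, 0 ≤ Gr (q ^ 4) (ib 4) x := fun x =>
    Finset.sum_nonneg fun i _ => PopPow_nonneg i (ib_nonneg 4) x
  rw [Finset.mem_Icc] at hj
  have h1 : ∑ i ∈ Finset.range (q ^ 2), Gr (q ^ 4) (ib 4) (ω j - ω (j + i + 1)) ≤
      ∑ l ∈ Finset.Icc T (N + q ^ 2), Gr (q ^ 4) (ib 4) (ω j - ω l) := by
    have e : ∑ i ∈ Finset.range (q ^ 2), Gr (q ^ 4) (ib 4) (ω j - ω (j + i + 1)) =
        ∑ l ∈ (Finset.range (q ^ 2)).map ⟨fun i => j + i + 1, fun a b hab => by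
          simp only at hab; omega⟩, Gr (q ^ 4) (ib 4) (ω j - ω l) := by
      rw [Finset.sum_map]; rfl
    rw [e]
    refine Finset.sum_le_sum_of_subset_of_nonneg ?_ fun l _ _ => hnn _
    intro l hl
    rw [Finset.mem_map] at hl
    obtain ⟨i, hi, rfl⟩ := hl
    rw [Finset.mem_range] at hi
    show j + i + 1 ∈ Finset.Icc T (N + q ^ 2)
    rw [Finset.mem_Icc]
    omega
  refine le_trans ?_ h1
  have h2 : ∀ i ∈ Finset.range (q ^ 2), psi (ω j - ω (j + i + 1)) - C1 / (q : ℝ) ^ 2 ≤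
      Gr (q ^ 4) (ib 4) (ω j - ω (j + i + 1)) := by
    intro i _
    refine le_trans ?_ (Gr_psi (q ^ 4) _)
    have := PopPow_psi_le q hq (ω j - ω (j + i + 1))
    unfold C1
    linarith
  refine le_trans ?_ (Finset.sum_le_sum h2)
  have h3 := good_sum (q ^ 2) j ω h
  rw [Finset.sum_sub_distrib, Finset.sum_const, Finset.card_range, nsmul_eq_mul]
  have hq' : (q : ℝ) ≠ 0 := by positivity
  have e : ((q ^ 2 : ℕ) : ℝ) * (C1 / (q : ℝ) ^ 2) = C1 := by push_cast; field_simp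
  rw [e]
  linarith

theorem hit_range_le (q T N k : ℕ) (hq : 0 < q) (ω : ℕ → Zd 4) (hH : 6 * C1 ≤ harm (q ^ 2))
    (z : Zd 4) :
    hit (walkRange ω T N) k z ≤
      6 / harm (q ^ 2) * (∑ i ∈ Finset.range (k + q ^ 4), ∑ j ∈ Finset.Icc T (N + q ^ 2),
        (Pop 4 ^ i) (ib 4) (z - ω j)) +
      ∑ i ∈ Finset.range (k + 1), ∑ j ∈ Finset.Icc T N,
        (Pop 4 ^ i) dl (z - ω j) * (if bad (q ^ 2) j ω then (1 : ℝ) else 0) := by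
  have hH0 := harm_pos (m := q ^ 2) (by positivity)
  set Sg := ((Finset.Icc T N).filter fun j => ¬ bad (q ^ 2) j ω).image ω with hSg
  set Sb := ((Finset.Icc T N).filter fun j => bad (q ^ 2) j ω).image ω with hSb
  have hsub : walkRange ω T N ⊆ Sg ∪ Sb := by
    intro x hx
    simp only [walkRange, Finset.mem_image] at hx
    obtain ⟨j, hj, rfl⟩ := hx
    rw [Finset.mem_union]
    by_cases hb : bad (q ^ 2) j ω
    · right; exact Finset.mem_image_of_mem _ (Finset.mem_filter.2 ⟨hj, hb⟩)
    · left; exact Finset.mem_image_of_mem _ (Finset.mem_filter.2 ⟨hj, hb⟩)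
  refine (hit_mono_set (by norm_num) hsub k z).trans ((hit_union Sg Sb k z).trans ?_)
  refine add_le_add ?_ ?_
  · have h1 := hit_le_Gr (f := fun x => ∑ l ∈ Finset.Icc T (N + q ^ 2), ib 4 (x - ω l))
      (fun x => Finset.sum_nonneg fun j _ => ib_nonneg _ _) Sg (harm (q ^ 2) / 6) (q ^ 4) ?_ k z
    · rw [Gr_translate_sum] at h1
      unfold Gr at h1
      rw [Finset.sum_comm] at h1
      rw [div_mul_eq_mul_div, le_div_iff₀ hH0]
      linarith
    · intro x hx
      rw [hSg, Finset.mem_image] at hx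
      obtain ⟨j, hj, rfl⟩ := hx
      rw [Finset.mem_filter] at hj
      exact good_Gr q T N j hq ω hj.1 hj.2 hH
  · refine (hit_le_sum ((Finset.Icc T N).filter fun j => bad (q ^ 2) j ω) ω Sb ?_ k z).trans
      (le_of_eq ?_)
    · intro x hx
      rw [hSb, Finset.mem_image] at hx
      exact hx
    · refine Finset.sum_congr rfl fun i _ => ?_
      rw [Finset.sum_filter]
      refine Finset.sum_congr rfl fun j _ => ?_
      split_ifs <;> simp

theorem refl_fs {d : ℕ} {g : Zd d → ℝ} (hg : g.support.Finite) (z : Zd d) :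
    (Function.support fun x => g (z - x)).Finite :=
  hg.preimage (f := fun x => z - x) (fun a _ b _ h => by simpa using h)

theorem tsum_refl {d : ℕ} (g : Zd d → ℝ) (z : Zd d) : ∑' x, g (z - x) = ∑' x, g x :=
  (Equiv.subLeft z).tsum_eq g

theorem visit_term {i j : ℕ} (hj : 0 < j) {g : Zd 4 → ℝ} (hg : g.support.Finite)
    (hg0 : ∀ x, 0 ≤ g x) (y z : Zd 4) :
    (Pop 4 ^ j) (fun x => (Pop 4 ^ i) g (z - x)) y ≤ kc 4 / (j : ℝ) ^ 2 * ∑' x, g x := by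
  have h := visit4 j hj (refl_fs (PopPow_fs hg i) z) (fun x => PopPow_nonneg i hg0 (z - x)) y
  rw [tsum_refl ((Pop 4 ^ i) g) z, tsum_PopPow (by norm_num) i hg] at h
  exact h

theorem ev_bad_term (m j N : ℕ) (hm : 0 < m) (hj : 0 < j) (hN : j ≤ N) {g : Zd 4 → ℝ}
    (hg0 : ∀ x, 0 ≤ g x) (w : ℕ → Zd 4) :
    ev (N + m) 0 w (fun ω => g (ω j) * (if bad m j ω then (1 : ℝ) else 0)) ≤
      4 / harm m * (Pop 4 ^ j) g (w 0) := by
  obtain ⟨l, rfl⟩ := Nat.exists_eq_add_of_le hN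
  have h1 : ∀ ω : ℕ → Zd 4, ev (m + l) (0 + j) ω
      (fun ω => g (ω j) * (if bad m j ω then (1 : ℝ) else 0)) ≤ 4 / harm m * g (ω (0 + j)) := by
    intro ω
    rw [zero_add]
    have h2 : ev (m + l) j ω (fun ω => g (ω j) * (if bad m j ω then (1 : ℝ) else 0)) =
        g (ω j) * ev (m + l) j ω (fun ω => if bad m j ω then (1 : ℝ) else 0) := by
      rw [← ev_mul]
      refine ev_congr _ _ _ _ _ fun ω' h' => ?_
      rw [h' j le_rfl]
    have h3 : ev (m + l) j ω (fun ω => if bad m j ω then (1 : ℝ) else 0) =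
        ev m j ω (fun ω => if bad m j ω then (1 : ℝ) else 0) := by
      rw [ev_tower]
      refine ev_congr _ _ _ _ _ fun ω' _ => ?_
      rw [ev_congr l (j + m) ω' _ (fun _ => if bad m j ω' then (1 : ℝ) else 0),
        ev_const (by norm_num)]
      intro ω'' h''
      have : Wj m j ω'' = Wj m j ω' := by
        unfold Wj
        refine Finset.sum_congr rfl fun i hi => ?_
        have hi' := Finset.mem_range.1 hi
        rw [h'' (j + i + 1) (by omega), h'' j (by omega)]
      have hb : bad m j ω'' ↔ bad m j ω' := by unfold bad; rw [this]
      exact if_congr hb rfl rfl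
    rw [h2, h3, mul_comm]
    exact mul_le_mul_of_nonneg_right (ev_bad m j hm ω) (hg0 _)
  rw [show j + l + m = j + (m + l) by ring, ev_tower]
  refine (ev_mono _ _ _ _ _ fun ω _ => h1 ω).trans (le_of_eq ?_)
  rw [ev_mul, ev_pop]

theorem near_bound (q T N k : ℕ) (hq : 0 < q) (hT : 0 < T) (hH : 6 * C1 ≤ harm (q ^ 2))
    (hk : q ^ 4 ≤ k) (y z : Zd 4) :
    ev (N + q ^ 2) 0 (fun _ => y) (fun ω => hit (walkRange ω T N) k z) ≤
      200000 * kc 4 * k / (harm (q ^ 2) * T) := by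
  have hd : 0 < 4 := by norm_num
  have hT' : (0 : ℝ) < T := by exact_mod_cast hT
  have hH0 := harm_pos (m := q ^ 2) (by positivity)
  have hkc := kc_pos hd
  have hk1 : (1 : ℝ) ≤ k := by
    have : 1 ≤ q ^ 4 := Nat.one_le_pow _ _ hq
    exact_mod_cast this.trans hk
  have hk2 : (q : ℝ) ^ 4 ≤ k := by exact_mod_cast hk
  refine (ev_mono _ _ _ _ _ fun ω _ => hit_range_le q T N k hq ω hH z).trans ?_
  rw [ev_add, ev_mul, ev_sum hd, ev_sum hd]
  have h1 : ∀ i ∈ Finset.range (k + q ^ 4), ev (N + q ^ 2) 0 (fun _ => y) (fun ω =>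
      ∑ j ∈ Finset.Icc T (N + q ^ 2), (Pop 4 ^ i) (ib 4) (z - ω j)) ≤ kc 4 * 6561 * (2 / T) := by
    intro i _
    rw [ev_sum hd]
    have h2 : ∀ j ∈ Finset.Icc T (N + q ^ 2), ev (N + q ^ 2) 0 (fun _ => y) (fun ω =>
        (Pop 4 ^ i) (ib 4) (z - ω j)) ≤ kc 4 * 6561 * (1 / (j : ℝ) ^ 2) := by
      intro j hj
      rw [Finset.mem_Icc] at hj
      rw [ev_at hd j (N + q ^ 2) hj.2 _ (fun x => (Pop 4 ^ i) (ib 4) (z - x))]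
      refine (visit_term (by omega) (ib_fs 4) (ib_nonneg 4) y z).trans (le_of_eq ?_)
      rw [tsum_ib]
      push_cast
      ring
    refine (Finset.sum_le_sum h2).trans ?_
    rw [← Finset.mul_sum]
    gcongr
    exact sum_inv_sq_le T _ hT
  have h3 : ∀ i ∈ Finset.range (k + 1), ev (N + q ^ 2) 0 (fun _ => y) (fun ω =>
      ∑ j ∈ Finset.Icc T N, (Pop 4 ^ i) dl (z - ω j) *
        (if bad (q ^ 2) j ω then (1 : ℝ) else 0)) ≤ 4 / harm (q ^ 2) * kc 4 * (2 / T) := by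
    intro i _
    rw [ev_sum hd]
    have h2 : ∀ j ∈ Finset.Icc T N, ev (N + q ^ 2) 0 (fun _ => y) (fun ω =>
        (Pop 4 ^ i) dl (z - ω j) * (if bad (q ^ 2) j ω then (1 : ℝ) else 0)) ≤
          4 / harm (q ^ 2) * kc 4 * (1 / (j : ℝ) ^ 2) := by
      intro j hj
      rw [Finset.mem_Icc] at hj
      refine (ev_bad_term (q ^ 2) j N (by positivity) (by omega) hj.2
        (g := fun x => (Pop 4 ^ i) dl (z - x)) (fun x => PopPow_nonneg i dl_nonneg _) _).trans ?_
      have h4 := visit_term (i := i) (j := j) (by omega) dl_fs dl_nonneg y z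
      rw [tsum_dl, mul_one] at h4
      calc 4 / harm (q ^ 2) * (Pop 4 ^ j) (fun x => (Pop 4 ^ i) dl (z - x)) y
          ≤ 4 / harm (q ^ 2) * (kc 4 / (j : ℝ) ^ 2) := by gcongr
        _ = _ := by ring
    refine (Finset.sum_le_sum h2).trans ?_
    rw [← Finset.mul_sum]
    gcongr
    exact sum_inv_sq_le T _ hT
  have h4 := Finset.sum_le_sum h1
  have h5 := Finset.sum_le_sum h3
  rw [Finset.sum_const, Finset.card_range, nsmul_eq_mul] at h4 h5
  push_cast at h4 h5
  refine (add_le_add (mul_le_mul_of_nonneg_left h4 (by positivity)) h5).trans ?_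
  calc 6 / harm (q ^ 2) * (((k : ℝ) + (q : ℝ) ^ 4) * (kc 4 * 6561 * (2 / T))) +
        ((k : ℝ) + 1) * (4 / harm (q ^ 2) * kc 4 * (2 / T))
      ≤ 6 / harm (q ^ 2) * (((k : ℝ) + k) * (kc 4 * 6561 * (2 / T))) +
        ((k : ℝ) + k) * (4 / harm (q ^ 2) * kc 4 * (2 / T)) := by gcongr
    _ = 157480 * kc 4 * k / (harm (q ^ 2) * T) := by field_simp; ring
    _ ≤ _ := by gcongr; norm_num

theorem nbhd_finite {d : ℕ} (A : Finset (Zd d)) (L : ℝ) : (nbhd (A : Set (Zd d)) L).Finite := by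
  have : nbhd (A : Set (Zd d)) L ⊆ ⋃ z ∈ A, (fun y => y - z) ⁻¹' (boxF d ⌈L⌉₊ : Set (Zd d)) := by
    intro y hy
    obtain ⟨z, hz, h⟩ := hy
    simp only [Set.mem_iUnion]
    refine ⟨z, hz, ?_⟩
    simp only [Set.mem_preimage, Finset.mem_coe, boxF, Fintype.mem_piFinset, Finset.mem_Icc]
    intro i
    have h1 := (h i).trans (Nat.le_ceil L)
    rw [← Int.cast_abs] at h1
    have h2 : |y i - z i| ≤ (⌈L⌉₊ : ℤ) := by exact_mod_cast h1
    have := abs_le.1 h2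
    simpa using this
  refine Set.Finite.subset ?_ this
  refine Set.Finite.biUnion A.finite_toSet fun z _ => ?_
  exact (boxF d ⌈L⌉₊).finite_toSet.preimage (fun a _ b _ h => by simpa using h)

theorem subset_nbhd {d : ℕ} (A : Finset (Zd d)) (L : ℝ) (hL : 0 ≤ L) :
    (A : Set (Zd d)) ⊆ nbhd (A : Set (Zd d)) L := by
  intro z hz
  refine ⟨z, hz, fun i => ?_⟩
  simpa using hL

theorem main_four {Pw : Zd 4 → Measure (ℕ → Zd 4)} (hPw : IsSRWFamily 4 Pw)
    (A : Finset (Zd 4)) (y : Zd 4) (q T N k : ℕ) (s lam L : ℝ) (hlam : 0 ≤ lam) (hL : 0 ≤ L)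
    (hq : 0 < q) (hT : 0 < T) (hH : 6 * C1 ≤ harm (q ^ 2)) (hk : q ^ 4 ≤ k + 1)
    (hks : ⌊s / (Real.log s) ^ (10 : ℕ)⌋₊ = k + 1) :
    ∫ ω, capTrunc Pw (walkRange ω T N ∩ A) s ∂(Pw y) ≤
      (Set.ncard (nbhd (A : Set (Zd 4)) L) : ℝ) *
        (200000 * kc 4 / (harm (q ^ 2) * T) +
          16 * Real.exp (-lam * L + ((k : ℝ) + 1) * (lam ^ 2 / 2))) := by
  have hd : 0 < 4 := by norm_num
  have hT' : (0 : ℝ) < T := by exact_mod_cast hT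
  have hH0 := harm_pos (m := q ^ 2) (by positivity)
  have hkc := kc_pos hd
  have hfin := nbhd_finite A L
  set Bf := hfin.toFinset with hBf
  have hcard : Set.ncard (nbhd (A : Set (Zd 4)) L) = Bf.card :=
    Set.ncard_eq_toFinset_card _ hfin
  have hAB : A ⊆ Bf := by
    intro x hx
    rw [hBf, Set.Finite.mem_toFinset]
    exact subset_nbhd A L hL hx
  have hAc : (A.card : ℝ) ≤ Bf.card := by exact_mod_cast Finset.card_le_card hAB
  set E := Real.exp (-lam * L + ((k : ℝ) + 1) * (lam ^ 2 / 2)) with hE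
  have hE0 : 0 < E := Real.exp_pos _
  have hdet : ∀ ω : ℕ → Zd 4, capTrunc Pw (walkRange ω T N ∩ A) s ≤
      1 / ((k : ℝ) + 1) * (∑ z ∈ Bf, hit (walkRange ω T N) (k + 1) z +
        Bf.card * ((k : ℝ) + 1 + 1) * (8 * E)) := by
    intro ω
    refine (capTrunc_le hd hPw _ s k hks).trans ?_
    refine mul_le_mul_of_nonneg_left ?_ (by positivity)
    set S := walkRange ω T N ∩ A with hS
    set F := (hit_fs S (k + 1)).toFinset with hF
    have h1 : ∑' z, hit S (k + 1) z = ∑ z ∈ F, hit S (k + 1) z := by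
      apply tsum_eq_sum
      intro b hb
      by_contra h
      exact hb ((hit_fs S (k + 1)).mem_toFinset.2 h)
    rw [h1, ← Finset.sum_inter_add_sum_sdiff F Bf]
    refine add_le_add ?_ ?_
    · refine (Finset.sum_le_sum_of_subset_of_nonneg Finset.inter_subset_right
        fun z _ _ => hit_nonneg S _ z).trans ?_
      exact Finset.sum_le_sum fun z _ => hit_mono_set hd Finset.inter_subset_left _ z
    · have h2 : ∑ z ∈ F \ Bf, hit S (k + 1) z ≤ ∑ z ∈ F \ Bf, hit A (k + 1) z :=
        Finset.sum_le_sum fun z _ => hit_mono_set hd Finset.inter_subset_right _ z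
      have h3 := far_sum hd A lam L hlam (k + 1) (F \ Bf) (by
        intro z hz
        rw [Finset.mem_sdiff] at hz
        intro h
        exact hz.2 (hfin.mem_toFinset.2 h))
      push_cast at h3
      rw [← hE] at h3
      refine h2.trans (h3.trans ?_)
      calc (A.card : ℝ) * ((k : ℝ) + 1 + 1) * (2 * 4 * E)
          ≤ Bf.card * ((k : ℝ) + 1 + 1) * (2 * 4 * E) := by gcongr
        _ = _ := by ring
  rw [integral_eq_ev hd (hPw y) (N + q ^ 2)]
  · refine (ev_mono _ _ _ _ _ fun ω _ => hdet ω).trans ?_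
    rw [ev_mul, ev_add, ev_const hd, ev_sum hd]
    have h4 : ∑ z ∈ Bf, ev (N + q ^ 2) 0 (fun _ => y)
        (fun ω => hit (walkRange ω T N) (k + 1) z) ≤
        Bf.card * (200000 * kc 4 * ((k : ℝ) + 1) / (harm (q ^ 2) * T)) := by
      rw [← nsmul_eq_mul]
      refine Finset.sum_le_card_nsmul _ _ _ fun z _ => ?_
      have := near_bound q T N (k + 1) hq hT hH hk y z
      push_cast at this
      exact this
    rw [hcard]
    have hk0 : (0 : ℝ) < (k : ℝ) + 1 := by positivity
    calc 1 / ((k : ℝ) + 1) * (∑ z ∈ Bf, ev (N + q ^ 2) 0 (fun _ => y)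
        (fun ω => hit (walkRange ω T N) (k + 1) z) + Bf.card * ((k : ℝ) + 1 + 1) * (8 * E))
        ≤ 1 / ((k : ℝ) + 1) * (Bf.card * (200000 * kc 4 * ((k : ℝ) + 1) / (harm (q ^ 2) * T)) +
          Bf.card * ((k : ℝ) + 1 + ((k : ℝ) + 1)) * (8 * E)) := by
          gcongr
          linarith [Nat.cast_nonneg (α := ℝ) k]
      _ = _ := by field_simp; ring
  · intro ω ω' h
    have : walkRange ω T N = walkRange ω' T N := by
      unfold walkRange
      refine Finset.image_congr ?_
      intro t ht
      exact h t ((Finset.mem_Icc.1 ht).2.trans (by omega))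
    simp only [this]


theorem log_le_harm (m : ℕ) : Real.log ((m : ℝ) + 1) ≤ harm m := by
  induction m with
  | zero => simp [harm]
  | succ m ih =>
    have h1 : harm (m + 1) = harm m + 1 / ((m : ℝ) + 1) := by
      unfold harm; rw [Finset.sum_range_succ]
    have h2 : Real.log (((m : ℝ) + 1 + 1) / ((m : ℝ) + 1)) ≤ 1 / ((m : ℝ) + 1) := by
      have h3 : (0 : ℝ) < ((m : ℝ) + 1 + 1) / ((m : ℝ) + 1) := by positivity
      have h4 := Real.log_le_sub_one_of_pos h3
      have h5 : ((m : ℝ) + 1 + 1) / ((m : ℝ) + 1) - 1 = 1 / ((m : ℝ) + 1) := by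
        field_simp; ring
      linarith
    rw [Real.log_div (by positivity) (by positivity)] at h2
    push_cast
    linarith

theorem fin_four {Pw : Zd 4 → Measure (ℕ → Zd 4)} (hPw : IsSRWFamily 4 Pw)
    (A : Finset (Zd 4)) (y : Zd 4) (R T N : ℕ) (K L : ℝ) (hK : 0 < K)
    (hT : 0 < T) (hTK : (T : ℝ) < K * (R : ℝ) ^ 2)
    (hl1 : 1 ≤ Real.log R) (hlC : 24 * C1 ≤ Real.log R)
    (hbig : (R : ℝ) ≤ (R : ℝ) ^ 2 / (Real.log ((R : ℝ) ^ 2)) ^ (10 : ℕ))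
    (hL : (R : ℝ) / Real.log R ≤ L) :
    ∫ ω, capTrunc Pw (walkRange ω T N ∩ A) ((R : ℝ) ^ 2) ∂(Pw y) ≤
      (800000 * kc 4 + 16 * K) * (Set.ncard (nbhd (A : Set (Zd 4)) L) : ℝ) / (T : ℝ)
        / Real.log R := by
  have hR0 : 0 < R := by
    rcases Nat.eq_zero_or_pos R with h | h
    · subst h; norm_num at hl1
    · exact h
  have hRr : (0 : ℝ) < R := by exact_mod_cast hR0
  set l := Real.log R with hl
  have hl0 : 0 < l := by linarith
  have hT0 : (0 : ℝ) < T := by exact_mod_cast hT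
  have hlog2 : Real.log ((R : ℝ) ^ 2) = 2 * l := by
    rw [Real.log_pow]; norm_num [hl]
  set S : ℝ := (R : ℝ) ^ 2 / (Real.log ((R : ℝ) ^ 2)) ^ (10 : ℕ) with hS
  have hS' : S = (R : ℝ) ^ 2 / (2 * l) ^ 10 := by rw [hS, hlog2]
  have hS0 : 0 < S := by linarith
  set q := Nat.sqrt (Nat.sqrt R) with hqd
  have hq : 0 < q := Nat.sqrt_pos.2 (Nat.sqrt_pos.2 hR0)
  have hq4 : q ^ 4 ≤ R := by
    have h1 : q ^ 2 ≤ Nat.sqrt R := Nat.sqrt_le' _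
    have h2 : (Nat.sqrt R) ^ 2 ≤ R := Nat.sqrt_le' _
    calc q ^ 4 = (q ^ 2) ^ 2 := by ring
      _ ≤ (Nat.sqrt R) ^ 2 := Nat.pow_le_pow_left h1 2
      _ ≤ R := h2
  have hq5 : R ≤ (q + 1) ^ 4 := by
    have h1 : Nat.sqrt R + 1 ≤ (q + 1) ^ 2 := Nat.lt_succ_sqrt' _
    have h2 : R < (Nat.sqrt R + 1) ^ 2 := Nat.lt_succ_sqrt' _
    calc R ≤ (Nat.sqrt R + 1) ^ 2 := h2.le
      _ ≤ ((q + 1) ^ 2) ^ 2 := Nat.pow_le_pow_left h1 2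
      _ = (q + 1) ^ 4 := by ring
  have hharm : l / 4 ≤ harm (q ^ 2) := by
    have h1 := log_le_harm (q ^ 2)
    have h2 : Real.log ((q : ℝ) + 1) ≤ Real.log (((q ^ 2 : ℕ) : ℝ) + 1) := by
      apply Real.log_le_log (by positivity)
      have : (1 : ℝ) ≤ q := by exact_mod_cast hq
      push_cast
      nlinarith
    have h3 : l ≤ 4 * Real.log ((q : ℝ) + 1) := by
      have h4 : Real.log R ≤ Real.log (((q : ℝ) + 1) ^ 4) := by
        apply Real.log_le_log hRr
        exact_mod_cast hq5
      rw [Real.log_pow] at h4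
      exact_mod_cast h4
    linarith
  have hflo : R ≤ ⌊S⌋₊ := Nat.le_floor hbig
  obtain ⟨k, hk⟩ : ∃ k, ⌊S⌋₊ = k + 1 := ⟨⌊S⌋₊ - 1, by omega⟩
  have hkS : (k : ℝ) + 1 ≤ S := by
    have := Nat.floor_le hS0.le
    rw [hk] at this
    exact_mod_cast this
  have hL0 : 0 ≤ L := le_trans (by positivity) hL
  have hmain := main_four hPw A y q T N k ((R : ℝ) ^ 2) (L / S) L (by positivity) hL0 hq hT
    (by linarith) (by omega) hk
  refine hmain.trans ?_
  have hkc : 0 < kc 4 := kc_pos (by norm_num)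
  have e1 : 200000 * kc 4 / (harm (q ^ 2) * T) ≤ 800000 * kc 4 / (T * l) := by
    calc 200000 * kc 4 / (harm (q ^ 2) * T) ≤ 200000 * kc 4 / (l / 4 * T) := by
          gcongr
      _ = 800000 * kc 4 / (T * l) := by field_simp; norm_num
  have e2 : -(L / S) * L + ((k : ℝ) + 1) * ((L / S) ^ 2 / 2) ≤ -(3 * l) := by
    have h1 : ((k : ℝ) + 1) * ((L / S) ^ 2 / 2) ≤ S * ((L / S) ^ 2 / 2) := by gcongr
    have h2 : -(L / S) * L + S * ((L / S) ^ 2 / 2) = -(L ^ 2 / (2 * S)) := by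
      field_simp; ring
    have h3 : 512 * l ^ 8 ≤ L ^ 2 / (2 * S) := by
      have h4 : ((R : ℝ) / l) ^ 2 / (2 * S) = 512 * l ^ 8 := by
        rw [hS']; field_simp; norm_num
      rw [← h4]
      gcongr
    have h5 : l ≤ l ^ 8 := le_self_pow₀ hl1 (by norm_num)
    linarith
  have e3 : Real.exp (-(L / S) * L + ((k : ℝ) + 1) * ((L / S) ^ 2 / 2)) ≤ K / (T * l) := by
    have h1 : Real.exp (-(3 * l)) = 1 / (R : ℝ) ^ 3 := by
      have : 3 * l = Real.log ((R : ℝ) ^ 3) := by rw [Real.log_pow]; norm_num [hl]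
      rw [Real.exp_neg, this, Real.exp_log (by positivity)]; simp
    refine (Real.exp_le_exp.2 e2).trans ?_
    rw [h1, div_le_div_iff₀ (by positivity) (by positivity)]
    have h2 : l ≤ R := by
      have := Real.log_le_sub_one_of_pos hRr
      linarith
    calc 1 * (T * l) ≤ (K * (R : ℝ) ^ 2) * R := by
          rw [one_mul]; exact mul_le_mul hTK.le h2 hl0.le (by positivity)
      _ = K * (R : ℝ) ^ 3 := by ring
  calc _ ≤ (Set.ncard (nbhd (A : Set (Zd 4)) L) : ℝ) *
        (800000 * kc 4 / (T * l) + 16 * (K / (T * l))) := by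
        gcongr
    _ = _ := by field_simp

theorem Rn_tendsto {ρ : ℕ → ℕ → ℝ} (hρ : Appropriate ρ) : Tendsto (Rn ρ) atTop atTop := by
  have h := hρ.2.2.1
  exact tendsto_nat_floor_atTop.comp (Real.tendsto_sqrt_atTop.comp h)

theorem log_pow_eventually : ∀ᶠ x : ℝ in atTop,
    x ≤ x ^ 2 / (Real.log (x ^ 2)) ^ (10 : ℕ) := by
  have h := (Real.isLittleO_pow_log_id_atTop (n := 10)).bound (c := 1 / 2 ^ 10) (by norm_num)
  filter_upwards [h, eventually_ge_atTop 3] with x hx h3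
  have hl : 0 < Real.log x := Real.log_pos (by linarith)
  rw [Real.norm_of_nonneg (by positivity), id, Real.norm_of_nonneg (by linarith)] at hx
  have h2 : Real.log (x ^ 2) = 2 * Real.log x := by rw [Real.log_pow]; norm_num
  rw [h2, le_div_iff₀ (by positivity), mul_pow]
  nlinarith

/-- **Lemma 5.6.** There is `C = C(d,K)` such that for all large `n`, all finite
nonempty `A`, all starting points `y` and all `0 < T < K R_n²`:
`E^y[cap(X[T,KR_n²] ∩ A, R_n²)] ≤ C|B(A,L_n)| T^{-1} (log R_n)^{-1}` when `d = 4`,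
and `E^y[|X[T,KR_n²] ∩ A|] ≤ C|A| T^{1-d/2}` when `d ≥ 5`. -/
theorem capacity_of_late_intersection
    (d : ℕ) (hd : 4 ≤ d) (ρ : ℕ → ℕ → ℝ) (hρ : Appropriate ρ)
    (Pw : Zd d → Measure (ℕ → Zd d)) (hPw : IsSRWFamily d Pw)
    (K : ℝ) (hK : 0 < K) :
    ∃ C : ℝ, 0 < C ∧ ∀ᶠ n in atTop,
      ∀ A : Finset (Zd d), A.Nonempty → ∀ y : Zd d, ∀ T : ℕ,
        0 < T → (T : ℝ) < K * (Rn ρ n : ℝ) ^ 2 →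
        (d = 4 →
          (∫ ω, capTrunc Pw (walkRange ω T ⌊K * (Rn ρ n : ℝ) ^ 2⌋₊ ∩ A)
              ((Rn ρ n : ℝ) ^ 2) ∂ (Pw y)) ≤
            C * (Set.ncard (nbhd (A : Set (Zd d)) (Ln d ρ n)) : ℝ) / (T : ℝ) / Real.log (Rn ρ n)) ∧
        (5 ≤ d →
          (∫ ω, ((walkRange ω T ⌊K * (Rn ρ n : ℝ) ^ 2⌋₊ ∩ A).card : ℝ) ∂ (Pw y)) ≤
            C * (A.card : ℝ) * (T : ℝ) ^ ((1 : ℝ) - (d : ℝ) / 2)) := by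
  have hk4 : 0 < kc 4 := kc_pos (by norm_num)
  have hkd : 0 < kc d := kc_pos (by omega)
  rcases Nat.lt_or_ge 4 d with h5 | h4
  · refine ⟨2 * kc d, by positivity, Eventually.of_forall ?_⟩
    intro n A _ y T hT _
    refine ⟨fun h => by omega, fun h => ?_⟩
    exact case_five h (hPw y) A T _ hT
  · obtain rfl : d = 4 := by omega
    refine ⟨800000 * kc 4 + 16 * K, by positivity, ?_⟩
    have hR : Tendsto (fun n => ((Rn ρ n : ℕ) : ℝ)) atTop atTop :=
      tendsto_natCast_atTop_atTop.comp (Rn_tendsto hρ)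
    have hlog := Real.tendsto_log_atTop.comp hR
    filter_upwards [hlog.eventually_ge_atTop 1, hlog.eventually_ge_atTop (24 * C1),
      hR.eventually log_pow_eventually] with n h1 h2 h3
    intro A _ y T hT hTK
    refine ⟨fun _ => ?_, fun h => by omega⟩
    refine fin_four hPw A y (Rn ρ n) T _ K _ hK hT hTK h1 h2 h3 ?_
    have h1' : 1 ≤ Real.log (Rn ρ n) := h1
    rw [Ln, if_pos rfl, div_eq_mul_inv, ← Real.rpow_neg_one]
    gcongr
    · norm_num [cConst]


end FRIPaper
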